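/- For every linear ordinal margin matrix with exactly 7 alternatives that has exactly one Split Cycle winner, the SSV winner is that Split Cycle winner. -/

import Mathlib

variable {X : Type} [DecidableEq X]

/-- `(V, succ)` is an ordinal margin matrix: `V` is a nonempty (finite) set of alternatives
and `succ` (the relation `≻`) is asymmetric, negatively transitive, and ordinally
skew-symmetric on `V × V`. -/
def IsOMM (V : Finset X) (succ : X × X → X × X → Prop) : Prop :=
  V.Nonempty ∧
  (∀ p q : X × X, p.1 ∈ V → p.2 ∈ V → q.1 ∈ V → q.2 ∈ V → succ p q → ¬ succ q p) ∧
  (∀ p q r : X × X, p.1 ∈ V → p.2 ∈ V → q.1 ∈ V → q.2 ∈ V → r.1 ∈ V → r.2 ∈ V →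
      ¬ succ p q → ¬ succ q r → ¬ succ p r) ∧
  (∀ a b c d : X, a ∈ V → b ∈ V → c ∈ V → d ∈ V →
      (succ (a, b) (c, d) ↔ succ (d, c) (b, a)))

/-- A linear ordinal margin matrix: additionally `≻` is connected on pairs of
distinct alternatives, hence a strict linear order there. -/
def IsLinearOMM (V : Finset X) (succ : X × X → X × X → Prop) : Prop :=
  IsOMM V succ ∧
  ∀ a b c d : X, a ∈ V → b ∈ V → c ∈ V → d ∈ V → a ≠ b → c ≠ d → (a, b) ≠ (c, d) →
    (succ (a, b) (c, d) ∨ succ (c, d) (a, b))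

/-- `a` defeats `b` according to Split Cycle in `(V, succ)`: `(a,b) ≻ (b,a)` and there is no
cycle in the majority graph (a duplicate-free list `l` of vertices of `V` whose consecutive
steps, including the wrap-around step — i.e. all the pairs of `l.zip (l.rotate 1)` — are
majority edges) such that `(a,b)` is an edge of the cycle that is weakest in the cycle,
i.e. `(a,b)` is not `≻`-stronger than any edge of the cycle. -/
def SCdefeats (V : Finset X) (succ : X × X → X × X → Prop) (a b : X) : Prop :=
  a ∈ V ∧ b ∈ V ∧ succ (a, b) (b, a) ∧
    ¬ ∃ l : List X, l.Nodup ∧ (∀ x ∈ l, x ∈ V) ∧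
        (∀ e ∈ l.zip (l.rotate 1), succ (e.1, e.2) (e.2, e.1)) ∧
        (a, b) ∈ l.zip (l.rotate 1) ∧
        (∀ e ∈ l.zip (l.rotate 1), ¬ succ (a, b) (e.1, e.2))

/-- `a` is a Split Cycle winner in `(V, succ)`: `a` is not defeated by any alternative. -/
def SCwinner (V : Finset X) (succ : X × X → X × X → Prop) (a : X) : Prop :=
  a ∈ V ∧ ∀ b ∈ V, ¬ SCdefeats V succ b a

/-- Auxiliary definition of Simple Stable Voting winners, by recursion on a fuel parameter
that is always instantiated to the cardinality of the set of alternatives (deleting a member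
of `V` decreases the cardinality by exactly one, so the fuel always matches). -/
def SSVwinAux (succ : X × X → X × X → Prop) : ℕ → Finset X → X → Prop
  | 0, _, _ => False
  | n + 1, V, a =>
      V = {a} ∨
        (1 < V.card ∧ ∃ b ∈ V, a ∈ V.erase b ∧ SSVwinAux succ n (V.erase b) a ∧
          ∀ c d : X, d ∈ V → c ∈ V.erase d → (c, d) ≠ (a, b) →
            SSVwinAux succ n (V.erase d) c → succ (a, b) (c, d))

/-- `a` is a Simple Stable Voting (SSV) winner in `(V, succ)`: either `V = {a}`, or there is
`b` such that `a` is the SSV winner of `V` with `b` deleted and `(a,b)` is the `≻`-maximal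
pair `(c,d)` of distinct alternatives such that `c` is the SSV winner of `V` with `d`
deleted (i.e. `(a,b)` is `≻`-stronger than every other such pair). -/
def SSVwin (V : Finset X) (succ : X × X → X × X → Prop) (a : X) : Prop :=
  SSVwinAux succ V.card V a

/-- Auxiliary definition of Stable Voting winners (fuel-indexed as in `SSVwinAux`). -/
def SVwinAux (succ : X × X → X × X → Prop) : ℕ → Finset X → X → Prop
  | 0, _, _ => False
  | n + 1, V, a =>
      V = {a} ∨
        (1 < V.card ∧ ∃ b ∈ V, a ∈ V.erase b ∧ SCwinner V succ a ∧
          SVwinAux succ n (V.erase b) a ∧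
          ∀ c d : X, d ∈ V → c ∈ V.erase d → (c, d) ≠ (a, b) →
            SCwinner V succ c → SVwinAux succ n (V.erase d) c → succ (a, b) (c, d))

/-- `a` is a Stable Voting (SV) winner in `(V, succ)`: like SSV, but the witnessing pairs
`(c,d)` must additionally have `c` a Split Cycle winner of `(V, succ)`. -/
def SVwin (V : Finset X) (succ : X × X → X × X → Prop) (a : X) : Prop :=
  SVwinAux succ V.card V a

/-- Auxiliary definition of SSV-SE winners (fuel-indexed as in `SSVwinAux`). -/
def SSVSEwinAux (succ : X × X → X × X → Prop) : ℕ → Finset X → X → Prop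
  | 0, _, _ => False
  | n + 1, V, a =>
      V = {a} ∨
        (1 < V.card ∧ ∃ b ∈ V, a ∈ V.erase b ∧ SSVSEwinAux succ n (V.erase b) a ∧
          ∀ c d : X, d ∈ V → c ∈ V.erase d → SSVSEwinAux succ n (V.erase d) c →
            ¬ succ (c, d) (a, b))

/-- `a` is a Simple Stable Voting with Simultaneous Elimination (SSV-SE) winner in
`(V, succ)`: either `V = {a}`, or `a` is the first coordinate of a `≻`-maximal element
`(a,b)` of the set of pairs `(c,d)` of distinct alternatives such that `c` is an SSV-SE
winner of `V` with `d` deleted (maximal: no such pair is `≻`-stronger than `(a,b)`). -/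
def SSVSEwin (V : Finset X) (succ : X × X → X × X → Prop) (a : X) : Prop :=
  SSVSEwinAux succ V.card V a

/-- `succ'` is a linearization of `succ` on `V`: `succ'` is a linear ordinal margin matrix
relation on `V` extending `succ` on `V`. -/
def IsLinearization (V : Finset X) (succ succ' : X × X → X × X → Prop) : Prop :=
  IsLinearOMM V succ' ∧
  ∀ p q : X × X, p.1 ∈ V → p.2 ∈ V → q.1 ∈ V → q.2 ∈ V → succ p q → succ' p q

/-- `a` is an SSV-PUT (parallel-universe tiebreaking) winner in `(V, succ)`:
`a` is the SSV winner of some linearization of `(V, succ)`. -/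
def SSVPUTwin (V : Finset X) (succ : X × X → X × X → Prop) (a : X) : Prop :=
  ∃ succ' : X × X → X × X → Prop, IsLinearization V succ succ' ∧ SSVwin V succ' a

/-- `r` is a strict linear order on (the elements of) `V`. -/
def IsLinOrderOn (V : Finset X) (r : X → X → Prop) : Prop :=
  (∀ a ∈ V, ¬ r a a) ∧
  (∀ a ∈ V, ∀ b ∈ V, ∀ c ∈ V, r a b → r b c → r a c) ∧
  (∀ a ∈ V, ∀ b ∈ V, a ≠ b → (r a b ∨ r b a))

open Classical in
/-- The margin of `a` vs. `b` in the profile `P` with voters `Fin m`: the number of voters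
ranking `a` above `b` minus the number of voters ranking `b` above `a`. -/
noncomputable def margin {m : ℕ} (P : Fin m → X → X → Prop) (a b : X) : ℤ :=
  ((Finset.univ.filter fun i => P i a b).card : ℤ) -
  ((Finset.univ.filter fun i => P i b a).card : ℤ)

/-! ### A small verified clause checker -/

namespace SSV

/-- Negation of a literal code (`2 * k` is atom `k`, `2 * k + 1` its negation). -/
def neg (l : ℕ) : ℕ := if l % 2 = 0 then l + 1 else l - 1

/-- Unit propagation along a list of clause codes; `none` means a conflict was reached. -/
def run (cl : ℕ → List ℕ) : List ℕ → ℕ → Option ℕ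
  | [], σ => some σ
  | h :: hs, σ =>
    match (cl h).filter (fun l => !σ.testBit (neg l)) with
    | [] => none
    | [l] => run cl hs (σ ||| 2 ^ l)
    | _ => run cl hs σ

/-- A refutation tree: propagate, and then either close or branch on an atom. -/
inductive Tr where
  | close (hs : List ℕ) : Tr
  | split (hs : List ℕ) (v : ℕ) (l r : Tr) : Tr

def chk (cl : ℕ → List ℕ) : Tr → ℕ → Bool
  | .close hs, σ => (run cl hs σ).isNone
  | .split hs v l r, σ =>
    match run cl hs σ with
    | none => true
    | some τ => chk cl l (τ ||| 2 ^ (2 * v)) && chk cl r (τ ||| 2 ^ (2 * v + 1))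

/-- Truth of a literal under a valuation of the atoms. -/
def lit (at_ : ℕ → Prop) (l : ℕ) : Prop := if l % 2 = 0 then at_ (l / 2) else ¬ at_ (l / 2)

theorem lit_even (at_ : ℕ → Prop) (k : ℕ) : lit at_ (2 * k) ↔ at_ k := by
  have h1 : (2 * k) % 2 = 0 := by omega
  have h2 : (2 * k) / 2 = k := by omega
  simp [lit]

theorem lit_odd (at_ : ℕ → Prop) (k : ℕ) : lit at_ (2 * k + 1) ↔ ¬ at_ k := by
  have h1 : ¬ (2 * k + 1) % 2 = 0 := by omega
  have h2 : (2 * k + 1) / 2 = k := by omega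
  simp only [lit, h1, h2, if_false]

theorem lit_neg (at_ : ℕ → Prop) (l : ℕ) : lit at_ (neg l) ↔ ¬ lit at_ l := by
  rcases Nat.even_or_odd' l with ⟨k, rfl | rfl⟩
  · have : neg (2 * k) = 2 * k + 1 := by simp [neg]
    rw [this, lit_even, lit_odd]
  · have : neg (2 * k + 1) = 2 * k := by
      have h1 : ¬ (2 * k + 1) % 2 = 0 := by omega
      simp only [neg, h1, if_false]; omega
    rw [this, lit_even, lit_odd, not_not]

def Inv (at_ : ℕ → Prop) (σ : ℕ) : Prop := ∀ i, σ.testBit i = true → lit at_ i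

theorem Inv.ins {at_ : ℕ → Prop} {σ l : ℕ} (h : Inv at_ σ) (hl : lit at_ l) :
    Inv at_ (σ ||| 2 ^ l) := by
  intro i hi
  rw [Nat.testBit_or, Nat.testBit_two_pow] at hi
  rcases Bool.or_eq_true _ _ |>.mp hi with h1 | h1
  · exact h i h1
  · have : l = i := by simpa using h1
    exact this ▸ hl

theorem run_sound {at_ : ℕ → Prop} {cl : ℕ → List ℕ} (hcl : ∀ h, ∃ l ∈ cl h, lit at_ l) :
    ∀ (hs : List ℕ) (σ : ℕ), Inv at_ σ → ∃ τ, run cl hs σ = some τ ∧ Inv at_ τ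
  | [], σ, h => ⟨σ, rfl, h⟩
  | h :: hs, σ, hσ => by
    obtain ⟨l, hl, hlt⟩ := hcl h
    have hmem : l ∈ (cl h).filter (fun l => !σ.testBit (neg l)) := by
      rw [List.mem_filter]
      refine ⟨hl, ?_⟩
      by_contra hc
      have : σ.testBit (neg l) = true := by simpa using hc
      exact (lit_neg at_ l).1 (hσ _ this) hlt
    unfold run
    generalize (cl h).filter (fun l => !σ.testBit (neg l)) = c at hmem
    match c, hmem with
    | [], hm => simp at hm
    | [l'], hm =>
      have : l = l' := by simpa using hm
      subst this
      exact run_sound hcl hs _ (hσ.ins hlt)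
    | _ :: _ :: _, _ => exact run_sound hcl hs _ hσ

theorem chk_sound {at_ : ℕ → Prop} {cl : ℕ → List ℕ} (hcl : ∀ h, ∃ l ∈ cl h, lit at_ l) :
    ∀ (t : Tr) (σ : ℕ), Inv at_ σ → chk cl t σ = true → False
  | .close hs, σ, hσ, h => by
    obtain ⟨τ, h1, _⟩ := run_sound hcl hs σ hσ
    simp [chk, h1] at h
  | .split hs v l r, σ, hσ, h => by
    obtain ⟨τ, h1, h2⟩ := run_sound hcl hs σ hσ
    simp only [chk, h1, Bool.and_eq_true] at h
    by_cases hv : at_ v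
    · exact chk_sound hcl l _ (h2.ins ((lit_even at_ v).2 hv)) h.1
    · exact chk_sound hcl r _ (h2.ins ((lit_odd at_ v).2 hv)) h.2

/-- The initial set of known literals. -/
def start (init : List ℕ) : ℕ := init.foldl (fun σ l => σ ||| 2 ^ l) 0

theorem start_inv {at_ : ℕ → Prop} (init : List ℕ) (h : ∀ l ∈ init, lit at_ l) :
    Inv at_ (start init) := by
  have key : ∀ (ls : List ℕ) (σ : ℕ), (∀ l ∈ ls, lit at_ l) → Inv at_ σ →
      Inv at_ (ls.foldl (fun σ l => σ ||| 2 ^ l) σ) := by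
    intro ls
    induction ls with
    | nil => intro σ _ hσ; exact hσ
    | cons a t ih =>
      intro σ hl hσ
      exact ih _ (fun l hl' => hl l (List.mem_cons_of_mem _ hl')) (hσ.ins (hl a List.mem_cons_self))
  refine key init 0 h ?_
  intro i hi
  simp at hi

/-! ### The clauses for six alternatives

Alternatives are coded by `0, …, 5`, ordered pairs `(x, y)` by `6 * x + y`, sets of alternatives
by bit masks. -/

/-- The reversed pair. -/
def rev (p : ℕ) : ℕ := 6 * (p % 6) + p / 6

/-- `p` codes a pair of distinct alternatives. -/
def ok (p : ℕ) : Bool := decide (p < 36) && !decide (p / 6 = p % 6)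

/-- The literal saying that the pair `p` is stronger than the pair `q`. -/
def gtl (p q : ℕ) : ℕ :=
  let a := min (36 * p + q) (36 * rev q + rev p)
  let b := min (36 * q + p) (36 * rev p + rev q)
  if a < b then 2 * a else 2 * b + 1

/-- The literal saying that `p` is a majority edge. -/
def posl (p : ℕ) : ℕ := gtl p (rev p)

/-- The literal saying that `x` is the SSV winner in `U`. -/
def winl (U x : ℕ) : ℕ := 2 * (1296 + (6 * U + x))

/-- The literal saying that `y` is the second coordinate of the maximal pair of `U`. -/
def topl (U y : ℕ) : ℕ := 2 * (2000 + (6 * U + y))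

/-- The literal saying that `x` is in the distinguished cut. -/
def cutl (x : ℕ) : ℕ := 2 * (3000 + x)

def bits (U : ℕ) : List ℕ := [0, 1, 2, 3, 4, 5].filter (fun i => U.testBit i)

def has (U x : ℕ) : Bool := decide (x < 6) && U.testBit x

def del (U y : ℕ) : ℕ := U ^^^ 2 ^ y

def triv : List ℕ := [0, 1]

/-- Mask of a nonempty proper subset. -/
def good (U : ℕ) : Bool :=
  [0, 1, 2, 3, 4, 5].any (fun i => U.testBit i) && [0, 1, 2, 3, 4, 5].any (fun i => !U.testBit i)

/-- The literals of a cut clause: some edge leaving `Z` inside `U` is stronger than `(y, x)`. -/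
def cutlits (U x y Z : ℕ) : List ℕ :=
  (bits U).flatMap fun p => (bits U).filterMap fun q =>
    if Z.testBit p && !Z.testBit q && !decide (p = x ∧ q = y) then
      some (gtl (6 * p + q) (6 * y + x)) else none

/-- The clause with a given code. -/
def clause (h : ℕ) : List ℕ :=
  let a := h / 16 % 64
  let b := h / 1024 % 64
  let c := h / 65536 % 64
  let d := h / 4194304 % 64
  match h % 16 with
  | 0 => -- transitivity
    if ok a && ok b && ok c && !decide (a = b) && !decide (b = c) && !decide (a = c) then
      [neg (gtl a b), neg (gtl b c), gtl a c] else triv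
  | 1 => -- majority edges are stronger than the others
    if ok a && ok b && !decide (a = b) then [neg (posl a), posl b, gtl a b] else triv
  | 2 => -- there is a winner
    if good a then (bits a).map (winl a) else triv
  | 3 => -- the winner is unique
    if decide (b < 6) && decide (c < 6) && !decide (b = c) then
      [neg (winl a b), neg (winl a c)] else triv
  | 4 => -- there is a maximal pair
    if good a && has a b && has a c && !decide (b = c) then (bits a).map (topl a) else triv
  | 5 => -- the maximal pair determines the winner
    if good a && has a b && has a c && !decide (b = c) then
      [neg (topl a c), neg (winl (del a c) b), winl a b] else triv
  | 6 => -- the maximal pair is maximal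
    if good a && ok b && ok c && has a (b % 6) && has a (c % 6) && !decide (b % 6 = c % 6) then
      [neg (topl a (b % 6)), neg (winl (del a (b % 6)) (b / 6)),
        neg (winl (del a (c % 6)) (c / 6)), gtl b c] else triv
  | 7 => -- winners of proper subsets are undefeated
    if good a && has a b && has a c && has d b && !d.testBit c then
      neg (winl a b) :: posl (6 * b + c) :: cutlits a b c d else triv
  | 8 => -- no strong edge leaves the cut
    if ok a && !decide (a = 6) then [neg (cutl (a / 6)), cutl (a % 6), neg (gtl a 6)] else triv
  | 9 => -- deleting `x` makes an alternative win that loses strongly to `x`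
    if ok a && !decide (a / 6 = 1) then [neg (winl (del 63 (a / 6)) (a % 6)), gtl a 6] else triv
  | _ => triv

/-- The finset coded by a mask. -/
def fs {X : Type} [DecidableEq X] (e : ℕ → X) (U : ℕ) : Finset X := ((bits U).map e).toFinset

/-- A hypothetical minimal counterexample on six alternatives. -/
structure Ctx (X : Type) [DecidableEq X] where
  m : X → X → ℤ
  e : ℕ → X
  S : Finset X → X
  E : Finset X → X
  R : Finset X
  anti : ∀ x y, m x y = - m y x
  einj : ∀ i < 6, ∀ j < 6, e i = e j → i = j
  minj : ∀ i < 6, ∀ j < 6, ∀ k < 6, ∀ l < 6, i ≠ j → k ≠ l → (i ≠ k ∨ j ≠ l) →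
    m (e i) (e j) ≠ m (e k) (e l)
  hS : ∀ B, B ⊂ fs e 63 → B.Nonempty → S B ∈ B
  hE : ∀ B, B ⊂ fs e 63 → 1 < B.card → E B ∈ B ∧ S (B.erase (E B)) = S B ∧
    ∀ d ∈ B, d ≠ E B → m (S (B.erase d)) d < m (S B) (E B)
  hC : ∀ B, B ⊂ fs e 63 → B.Nonempty → ∀ y ∈ B, m (S B) y < m y (S B) → ∀ Z : Finset X, S B ∈ Z →
    y ∉ Z → ∃ p ∈ B, p ∈ Z ∧ ∃ q ∈ B, q ∉ Z ∧ m y (S B) < m p q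
  hR : ∀ i < 6, ∀ j < 6, e i ∈ R → e j ∉ R → m (e i) (e j) < m (e 1) (e 0)
  hF : ∀ i < 6, i ≠ 1 → m (e 1) (e 0) < m (e i) (S ((fs e 63).erase (e i)))


def Ctx.M (K : Ctx X) (p : ℕ) : ℤ := K.m (K.e (p / 6)) (K.e (p % 6))

def Ctx.atom (K : Ctx X) (k : ℕ) : Prop :=
  if k < 1296 then K.M (k % 36) < K.M (k / 36)
  else if k < 2000 then K.S (fs K.e ((k - 1296) / 6)) = K.e ((k - 1296) % 6)
  else if k < 3000 then K.E (fs K.e ((k - 2000) / 6)) = K.e ((k - 2000) % 6)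
  else K.e (k - 3000) ∈ K.R

theorem mem_bits {U i : ℕ} : i ∈ bits U ↔ i < 6 ∧ U.testBit i = true := by
  simp only [bits, List.mem_filter, List.mem_cons, List.not_mem_nil, or_false]
  constructor
  · rintro ⟨h, h2⟩; exact ⟨by omega, h2⟩
  · rintro ⟨h, h2⟩; exact ⟨by omega, h2⟩

theorem mem_fs {e : ℕ → X} {U : ℕ} {x : X} :
    x ∈ fs e U ↔ ∃ i, i < 6 ∧ U.testBit i = true ∧ e i = x := by
  simp only [fs, List.mem_toFinset, List.mem_map, mem_bits, and_assoc]

theorem Ctx.mem_fs' (K : Ctx X) {U i : ℕ} (hi : i < 6) : K.e i ∈ fs K.e U ↔ U.testBit i = true := by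
  rw [mem_fs]
  constructor
  · rintro ⟨j, hj, h, he⟩
    rwa [← K.einj j hj i hi he]
  · intro h; exact ⟨i, hi, h, rfl⟩

theorem has_iff {U x : ℕ} : has U x = true ↔ x < 6 ∧ U.testBit x = true := by
  simp [has]

theorem Ctx.has_mem (K : Ctx X) {U x : ℕ} (h : has U x = true) : K.e x ∈ fs K.e U :=
  (K.mem_fs' (has_iff.1 h).1).2 (has_iff.1 h).2

theorem Ctx.fs_del (K : Ctx X) {U y : ℕ} (h : has U y = true) :
    fs K.e (del U y) = (fs K.e U).erase (K.e y) := by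
  obtain ⟨hy, hU⟩ := has_iff.1 h
  ext x
  rw [Finset.mem_erase, mem_fs, mem_fs]
  constructor
  · rintro ⟨i, hi, hb, rfl⟩
    rw [del, Nat.testBit_xor, Nat.testBit_two_pow] at hb
    have hne : i ≠ y := by
      rintro rfl
      simp [hU] at hb
    refine ⟨fun hc => hne (K.einj i hi y hy hc), i, hi, ?_, rfl⟩
    simpa [hne.symm] using hb
  · rintro ⟨hne, i, hi, hb, rfl⟩
    have hne' : y ≠ i := by rintro rfl; exact hne rfl
    refine ⟨i, hi, ?_, rfl⟩
    rw [del, Nat.testBit_xor, Nat.testBit_two_pow]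
    simp [hb, hne']

theorem Ctx.good_ssub (K : Ctx X) {U : ℕ} (h : good U = true) :
    fs K.e U ⊂ fs K.e 63 ∧ (fs K.e U).Nonempty := by
  have t63 : ∀ i < 6, Nat.testBit 63 i = true := by decide
  simp only [good, Bool.and_eq_true, List.any_eq_true] at h
  obtain ⟨⟨i, hi, hi'⟩, j, hj, hj'⟩ := h
  have hi6 : i < 6 := by simp at hi; omega
  have hj6 : j < 6 := by simp at hj; omega
  refine ⟨?_, K.e i, (K.mem_fs' hi6).2 hi'⟩
  rw [Finset.ssubset_iff_of_subset]
  · refine ⟨K.e j, (K.mem_fs' hj6).2 (t63 j hj6), ?_⟩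
    rw [K.mem_fs' hj6]
    simpa using hj'
  · intro x hx
    obtain ⟨k, hk, _, rfl⟩ := mem_fs.1 hx
    exact (K.mem_fs' hk).2 (t63 k hk)

theorem ok_iff {p : ℕ} : ok p = true ↔ p < 36 ∧ p / 6 ≠ p % 6 := by
  simp [ok]

theorem rev_lt {p : ℕ} (h : p < 36) : rev p < 36 := by unfold rev; omega

theorem Ctx.M_rev (K : Ctx X) {p : ℕ} (h : p < 36) : K.M (rev p) = - K.M p := by
  have h1 : rev p / 6 = p % 6 := by unfold rev; omega
  have h2 : rev p % 6 = p / 6 := by unfold rev; omega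
  unfold Ctx.M
  rw [h1, h2, K.anti]

theorem Ctx.M_inj (K : Ctx X) {p q : ℕ} (hp : ok p = true) (hq : ok q = true) (h : p ≠ q) :
    K.M p ≠ K.M q := by
  rw [ok_iff] at hp hq
  exact K.minj _ (by omega) _ (by omega) _ (by omega) _ (by omega) hp.2 hq.2 (by omega)

theorem Ctx.atom_gt (K : Ctx X) {p q : ℕ} (hp : p < 36) (hq : q < 36) :
    K.atom (36 * p + q) ↔ K.M q < K.M p := by
  have h1 : 36 * p + q < 1296 := by omega
  have h2 : (36 * p + q) / 36 = p := by omega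
  have h3 : (36 * p + q) % 36 = q := by omega
  simp only [Ctx.atom, h1, h2, h3, if_true]

theorem Ctx.gtl_iff (K : Ctx X) {p q : ℕ} (hp : ok p = true) (hq : ok q = true) (h : p ≠ q) :
    lit K.atom (gtl p q) ↔ K.M q < K.M p := by
  have hne := K.M_inj hp hq h
  have hp' := (ok_iff.1 hp).1
  have hq' := (ok_iff.1 hq).1
  have e1 := K.M_rev hp'
  have e2 := K.M_rev hq'
  have a1 := K.atom_gt hp' hq'
  have a2 := K.atom_gt (rev_lt hq') (rev_lt hp')
  have b1 := K.atom_gt hq' hp'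
  have b2 := K.atom_gt (rev_lt hp') (rev_lt hq')
  rw [e1, e2] at a2 b2
  unfold gtl
  simp only
  split_ifs with hc
  · rw [lit_even]
    rcases min_choice (36 * p + q) (36 * rev q + rev p) with hh | hh <;> rw [hh]
    · exact a1
    · rw [a2]; constructor <;> intro <;> omega
  · rw [lit_odd]
    rcases min_choice (36 * q + p) (36 * rev p + rev q) with hh | hh <;> rw [hh]
    · rw [b1]; constructor <;> intro <;> omega
    · rw [b2]; constructor <;> intro <;> omega

theorem ok_rev {p : ℕ} (h : ok p = true) : ok (rev p) = true ∧ p ≠ rev p := by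
  rw [ok_iff] at *
  refine ⟨⟨rev_lt h.1, ?_⟩, ?_⟩ <;> unfold rev <;> omega

theorem Ctx.posl_iff (K : Ctx X) {p : ℕ} (hp : ok p = true) :
    lit K.atom (posl p) ↔ 0 < K.M p := by
  unfold posl
  rw [K.gtl_iff hp (ok_rev hp).1 (ok_rev hp).2, K.M_rev (ok_iff.1 hp).1]
  constructor <;> intro <;> omega

theorem Ctx.winl_iff (K : Ctx X) {U x : ℕ} (hU : U < 64) (hx : x < 6) :
    lit K.atom (winl U x) ↔ K.S (fs K.e U) = K.e x := by
  have h1 : ¬ 1296 + (6 * U + x) < 1296 := by omega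
  have h2 : 1296 + (6 * U + x) < 2000 := by omega
  have h3 : (1296 + (6 * U + x) - 1296) / 6 = U := by omega
  have h4 : (1296 + (6 * U + x) - 1296) % 6 = x := by omega
  unfold winl
  rw [lit_even]
  simp only [Ctx.atom, h1, h2, h3, h4, if_true, if_false]

theorem Ctx.topl_iff (K : Ctx X) {U x : ℕ} (hU : U < 64) (hx : x < 6) :
    lit K.atom (topl U x) ↔ K.E (fs K.e U) = K.e x := by
  have h1 : ¬ 2000 + (6 * U + x) < 1296 := by omega
  have h2 : ¬ 2000 + (6 * U + x) < 2000 := by omega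
  have h2 : 2000 + (6 * U + x) < 3000 := by omega
  have h3 : (2000 + (6 * U + x) - 2000) / 6 = U := by omega
  have h4 : (2000 + (6 * U + x) - 2000) % 6 = x := by omega
  unfold topl
  rw [lit_even]
  simp only [Ctx.atom, *, if_true, if_false]

theorem Ctx.cutl_iff (K : Ctx X) {x : ℕ} : lit K.atom (cutl x) ↔ K.e x ∈ K.R := by
  have h1 : ¬ 3000 + x < 1296 := by omega
  have h2 : ¬ 3000 + x < 2000 := by omega
  have h2' : ¬ 3000 + x < 3000 := by omega
  have h3 : 3000 + x - 3000 = x := by omega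
  unfold cutl
  rw [lit_even]
  simp only [Ctx.atom, *, if_false]

theorem triv_sound (at_ : ℕ → Prop) : ∃ l ∈ triv, lit at_ l := by
  by_cases h : at_ 0
  · exact ⟨0, by simp [triv], (lit_even at_ 0).2 h⟩
  · exact ⟨1, by simp [triv], (lit_odd at_ 0).2 h⟩

theorem del_lt {U y : ℕ} (hU : U < 64) (hy : y < 6) : del U y < 64 := by
  unfold del
  have : 2 ^ y < 2 ^ 6 := Nat.pow_lt_pow_right (by norm_num) hy
  exact Nat.xor_lt_two_pow (n := 6) hU this

theorem three {at_ : ℕ → Prop} {a b c : ℕ} (h : lit at_ a → lit at_ b → lit at_ c) :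
    ∃ l ∈ [neg a, neg b, c], lit at_ l := by
  by_cases ha : lit at_ a
  · by_cases hb : lit at_ b
    · exact ⟨c, by simp, h ha hb⟩
    · exact ⟨neg b, by simp, (lit_neg _ _).2 hb⟩
  · exact ⟨neg a, by simp, (lit_neg _ _).2 ha⟩

theorem Ctx.clause_sound (K : Ctx X) (h : ℕ) : ∃ l ∈ clause h, lit K.atom l := by
  unfold clause
  have ha : h / 16 % 64 < 64 := Nat.mod_lt _ (by norm_num)
  generalize h / 16 % 64 = a at ha
  generalize h / 1024 % 64 = b
  generalize h / 65536 % 64 = c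
  generalize h / 4194304 % 64 = d
  simp only
  split
  · -- transitivity
    split_ifs with hg
    · simp only [Bool.and_eq_true, Bool.not_eq_true', decide_eq_false_iff_not] at hg
      obtain ⟨⟨⟨⟨⟨o1, o2⟩, o3⟩, n1⟩, n2⟩, n3⟩ := hg
      apply three
      rw [K.gtl_iff o1 o2 n1, K.gtl_iff o2 o3 n2, K.gtl_iff o1 o3 n3]
      intros; omega
    · exact triv_sound _
  · split_ifs with hg
    · simp only [Bool.and_eq_true, Bool.not_eq_true', decide_eq_false_iff_not] at hg
      obtain ⟨⟨o1, o2⟩, n1⟩ := hg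
      by_cases h1 : lit K.atom (posl a)
      · by_cases h2 : lit K.atom (posl b)
        · exact ⟨_, by simp, h2⟩
        · refine ⟨gtl a b, by simp, ?_⟩
          rw [K.posl_iff o1] at h1
          rw [K.posl_iff o2] at h2
          rw [K.gtl_iff o1 o2 n1]
          omega
      · exact ⟨neg (posl a), by simp, (lit_neg _ _).2 h1⟩
    · exact triv_sound _
  · split_ifs with hg
    · obtain ⟨h1, h2⟩ := K.good_ssub hg
      obtain ⟨i, hi, hb, he⟩ := mem_fs.1 (K.hS _ h1 h2)
      exact ⟨winl a i, List.mem_map_of_mem (mem_bits.2 ⟨hi, hb⟩), (K.winl_iff ha hi).2 he.symm⟩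
    · exact triv_sound _
  · split_ifs with hg
    · simp only [Bool.and_eq_true, Bool.not_eq_true', decide_eq_false_iff_not,
        decide_eq_true_eq] at hg
      obtain ⟨⟨h1, h2⟩, h3⟩ := hg
      by_cases hw : lit K.atom (winl a b)
      · refine ⟨neg (winl a c), by simp, (lit_neg _ _).2 fun hw' => h3 ?_⟩
        rw [K.winl_iff ha h1] at hw
        rw [K.winl_iff ha h2] at hw'
        exact K.einj _ h1 _ h2 (hw.symm.trans hw')
      · exact ⟨neg (winl a b), by simp, (lit_neg _ _).2 hw⟩
    · exact triv_sound _
  · split_ifs with hg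
    · simp only [Bool.and_eq_true, Bool.not_eq_true', decide_eq_false_iff_not] at hg
      obtain ⟨⟨⟨g, h1⟩, h2⟩, h3⟩ := hg
      have hc : 1 < (fs K.e a).card := Finset.one_lt_card.2
        ⟨_, K.has_mem h1, _, K.has_mem h2,
          fun hc => h3 (K.einj _ (has_iff.1 h1).1 _ (has_iff.1 h2).1 hc)⟩
      obtain ⟨i, hi, hb, he⟩ := mem_fs.1 (K.hE _ (K.good_ssub g).1 hc).1
      exact ⟨topl a i, List.mem_map_of_mem (mem_bits.2 ⟨hi, hb⟩), (K.topl_iff ha hi).2 he.symm⟩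
    · exact triv_sound _
  · split_ifs with hg
    · simp only [Bool.and_eq_true, Bool.not_eq_true', decide_eq_false_iff_not] at hg
      obtain ⟨⟨⟨g, h1⟩, h2⟩, h3⟩ := hg
      have hb6 := (has_iff.1 h1).1
      have hc6 := (has_iff.1 h2).1
      have hc : 1 < (fs K.e a).card := Finset.one_lt_card.2
        ⟨_, K.has_mem h1, _, K.has_mem h2, fun hc => h3 (K.einj _ hb6 _ hc6 hc)⟩
      apply three
      rw [K.topl_iff ha hc6, K.winl_iff (del_lt ha hc6) hb6, K.winl_iff ha hb6, K.fs_del h2]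
      intro e1 e2
      have := (K.hE _ (K.good_ssub g).1 hc).2.1
      rw [e1, e2] at this
      exact this.symm
    · exact triv_sound _
  · split_ifs with hg
    · simp only [Bool.and_eq_true, Bool.not_eq_true', decide_eq_false_iff_not] at hg
      obtain ⟨⟨⟨⟨⟨g, o1⟩, o2⟩, h1⟩, h2⟩, h3⟩ := hg
      have hb6 := (has_iff.1 h1).1
      have hc6 := (has_iff.1 h2).1
      have hb6' : b / 6 < 6 := by have := (ok_iff.1 o1).1; omega
      have hc6' : c / 6 < 6 := by have := (ok_iff.1 o2).1; omega
      have hc : 1 < (fs K.e a).card := Finset.one_lt_card.2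
        ⟨_, K.has_mem h1, _, K.has_mem h2, fun hc => h3 (K.einj _ hb6 _ hc6 hc)⟩
      by_cases w1 : lit K.atom (topl a (b % 6))
      · refine Exists.imp (fun l hl => ⟨List.mem_cons_of_mem _ hl.1, hl.2⟩)
          (three (a := winl (del a (b % 6)) (b / 6)) (b := winl (del a (c % 6)) (c / 6))
            (c := gtl b c) (at_ := K.atom) ?_)
        rw [K.topl_iff ha hb6] at w1
        rw [K.winl_iff (del_lt ha hb6) hb6', K.winl_iff (del_lt ha hc6) hc6', K.fs_del h1,
          K.fs_del h2, K.gtl_iff o1 o2 (by rintro rfl; exact h3 rfl)]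
        intro e1 e2
        obtain ⟨-, k1, k2⟩ := K.hE _ (K.good_ssub g).1 hc
        rw [w1, e1] at k1
        have := k2 (K.e (c % 6)) (K.has_mem h2) (by
          rw [w1]; intro hh; exact h3 (K.einj _ hc6 _ hb6 hh).symm)
        rw [w1, ← k1, e2] at this
        exact this
      · exact ⟨_, List.mem_cons_self, (lit_neg _ _).2 w1⟩
    · exact triv_sound _
  · split_ifs with hg
    · simp only [Bool.and_eq_true, Bool.not_eq_true'] at hg
      obtain ⟨⟨⟨⟨g, h1⟩, h2⟩, h3⟩, h4⟩ := hg
      have hb6 := (has_iff.1 h1).1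
      have hc6 := (has_iff.1 h2).1
      have hbc : b ≠ c := by
        rintro rfl
        rw [(has_iff.1 h3).2] at h4
        exact absurd h4 (by simp)
      have hM : ∀ p < 6, ∀ q < 6, K.M (6 * p + q) = K.m (K.e p) (K.e q) := by
        intro p hp q hq
        have e1 : (6 * p + q) / 6 = p := by omega
        have e2 : (6 * p + q) % 6 = q := by omega
        unfold Ctx.M
        rw [e1, e2]
      have hok : ∀ p < 6, ∀ q < 6, p ≠ q → ok (6 * p + q) = true := by
        intro p hp q hq hpq
        rw [ok_iff]; omega
      by_cases w1 : lit K.atom (winl a b)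
      · by_cases w2 : lit K.atom (posl (6 * b + c))
        · exact ⟨_, List.mem_cons_of_mem _ List.mem_cons_self, w2⟩
        · rw [K.winl_iff ha hb6] at w1
          rw [K.posl_iff (hok _ hb6 _ hc6 hbc), hM _ hb6 _ hc6] at w2
          have hne := K.minj _ hb6 _ hc6 _ hc6 _ hb6 hbc hbc.symm (Or.inl hbc)
          have ha' := K.anti (K.e b) (K.e c)
          obtain ⟨hs, hne'⟩ := K.good_ssub g
          obtain ⟨x, hx, hxZ, y, hy, hyZ, hlt⟩ := K.hC _ hs hne' (K.e c) (K.has_mem h2)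
            (by rw [w1]; omega) (fs K.e d) (by rw [w1]; exact K.has_mem h3)
            (by rw [K.mem_fs' hc6, h4]; simp)
          obtain ⟨i, hi, hib, rfl⟩ := mem_fs.1 hx
          obtain ⟨j, hj, hjb, rfl⟩ := mem_fs.1 hy
          rw [K.mem_fs' hi] at hxZ
          rw [K.mem_fs' hj] at hyZ
          rw [w1] at hlt
          have hij : i ≠ j := by rintro rfl; exact hyZ hxZ
          have hijn : ¬ (i = b ∧ j = c) := by
            rintro ⟨rfl, rfl⟩
            omega
          have hijn' : ¬ (i = c ∧ j = b) := by
            rintro ⟨rfl, rfl⟩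
            omega
          refine ⟨gtl (6 * i + j) (6 * c + b), ?_, ?_⟩
          · refine List.mem_cons_of_mem _ (List.mem_cons_of_mem _ ?_)
            unfold cutlits
            rw [List.mem_flatMap]
            refine ⟨i, mem_bits.2 ⟨hi, hib⟩, ?_⟩
            rw [List.mem_filterMap]
            refine ⟨j, mem_bits.2 ⟨hj, hjb⟩, ?_⟩
            have hyZ' : d.testBit j = false := by simpa using hyZ
            simp [hxZ, hyZ', hijn]
          · rw [K.gtl_iff (hok _ hi _ hj hij) (hok _ hc6 _ hb6 hbc.symm) (by omega),
              hM _ hi _ hj, hM _ hc6 _ hb6]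
            exact hlt
      · exact ⟨_, List.mem_cons_self, (lit_neg _ _).2 w1⟩
    · exact triv_sound _
  · split_ifs with hg
    · simp only [Bool.and_eq_true, Bool.not_eq_true', decide_eq_false_iff_not] at hg
      obtain ⟨o1, n1⟩ := hg
      have o2 : ok 6 = true := by decide
      have hlt := (ok_iff.1 o1).1
      by_cases w1 : lit K.atom (cutl (a / 6))
      · by_cases w2 : lit K.atom (cutl (a % 6))
        · exact ⟨_, by simp, w2⟩
        · refine ⟨neg (gtl a 6), by simp, ?_⟩
          rw [lit_neg, K.gtl_iff o1 o2 n1]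
          rw [K.cutl_iff] at w1 w2
          have := K.hR _ (by omega) _ (by omega) w1 w2
          exact not_lt.2 this.le
      · exact ⟨_, List.mem_cons_self, (lit_neg _ _).2 w1⟩
    · exact triv_sound _
  · split_ifs with hg
    · simp only [Bool.and_eq_true, Bool.not_eq_true', decide_eq_false_iff_not] at hg
      obtain ⟨o1, n1⟩ := hg
      have o2 : ok 6 = true := by decide
      have hlt := (ok_iff.1 o1).1
      have h6 : a / 6 < 6 := by omega
      have hh : has 63 (a / 6) = true := by
        have : ∀ i < 6, has 63 i = true := by decide
        exact this _ h6
      by_cases w1 : lit K.atom (winl (del 63 (a / 6)) (a % 6))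
      · refine ⟨gtl a 6, by simp, ?_⟩
        rw [K.winl_iff (del_lt (by norm_num) h6) (by omega), K.fs_del hh] at w1
        rw [K.gtl_iff o1 o2 (by rintro rfl; exact n1 (by norm_num))]
        have := K.hF _ h6 n1
        rw [w1] at this
        exact this
      · exact ⟨_, List.mem_cons_self, (lit_neg _ _).2 w1⟩
    · exact triv_sound _
  · exact triv_sound _

theorem Ctx.refute (K : Ctx X) (init : List ℕ) (t : Tr) (hi : ∀ l ∈ init, lit K.atom l)
    (hc : chk clause t (start init) = true) : False :=
  chk_sound K.clause_sound t _ (start_inv init hi) hc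

end SSV

/-! ### The refutation trees -/

namespace SSV

def tree42 : Tr :=
  .split [132051, 197587, 263123, 41, 249, 361, 131827, 132851, 199411, 330483, 425, 395280,
  143376, 40, 408592, 151568, 1003536, 248, 415760, 158736, 1010704, 1469456, 360, 147472, 409616,
  1458192, 1720336, 216, 33688775, 312, 408, 17041735, 536592, 540688, 544784, 551952, 54591735,
  121700855, 194, 602128, 606224, 610320, 617488, 667664, 671760, 675856, 683024, 322] 3005
  (.split [504, 733200, 737296, 741392, 155255415, 172032695, 505] 55 (.close [609296, 674832,
  740368, 239144887]) (.split [] 49 (.close [537616, 603152, 734224, 188812023]) (.split [864272]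
  603 (.split [67310023] 171 (.split [67309975, 67310039, 67310071] 572 (.split [167907015,
  167907047] 825 (.split [201528199] 130 (.close [1207312, 1207328, 1267760, 1333296, 1595440,
  27937, 33558007, 243273655, 346144, 184552183, 30769, 498, 4522967, 1578016, 117443063]) (.split
  [205722519] 76 (.split [] 102 (.split [150997591, 150997623, 184552183, 208912, 149520, 1183776,
  208928, 1192992, 1196064, 1199136, 1200160, 1205280, 1210400, 1211424, 18465, 4391127, 4391383,
  4391895, 1969168, 1184784, 1603632, 4391319, 1734704, 620592, 358448, 751664, 1184800,
  167777943, 167777975, 184555223, 159389303, 402, 151000663, 626, 594, 198389] 60 (.close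
  [397328, 155664, 286736, 352272, 226497399]) (.split [1589264] 174 (.split [201332503,
  218109783, 234887063] 826 (.split [] 1389 (.close [33688823, 37883127, 331509, 222495703,
  2112544, 16779479, 16780023, 613424, 1006640, 1203248, 2186288, 33885847, 33885879, 33885911,
  1146912, 210, 1133600, 1145888, 658, 690, 331477, 167909063, 167909095, 134870, 132853, 706,
  144086, 131796, 131797, 66293, 66292, 1781, 78582, 738]) (.split [] 87 (.close [1195040,
  2112544, 16779479, 16779511, 16780023, 150997751, 222495703, 1146912, 210, 242, 1133600,
  1145888, 1519648, 2182176, 2186272, 33885847, 33885879, 220886, 167909063, 167909095, 329461,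
  658, 690, 706, 144086, 134870, 132853, 131796, 131797, 66293, 66292, 1781, 78582, 738]) (.split
  [37883095, 172101335, 210] 1610 (.close [17042247, 151259975, 1721360, 1721392, 1738768,
  1738816, 1917088, 1733888, 2258176, 67441527, 521, 1925184, 1916992, 498, 104992247, 537,
  1069120, 416784, 613392, 678928, 2186256, 2251792, 155452375, 100994999, 1924160, 1537072,
  138609623]) (.split [] 1660 (.close [265155, 266179, 67310535, 201528263, 218305479, 1471744,
  1935712, 168040327, 1141888, 1141904, 1474816, 1792272, 1793296, 1474832, 50662375, 33689031,
  151263047, 898, 1541392, 134420167, 450, 834, 135109, 706, 330693, 1077190, 199620, 265157])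
  (.split [] 2266 (.close [134853, 642, 134420103, 1016518, 1147590, 24065, 578, 17441, 17825,
  2196166, 17042407, 104992247, 498, 521, 541712, 607248, 672784, 1262608, 50662135, 117771239,
  2245776, 2132112, 1137712, 1143856, 138609623]) (.split [] 2316 (.close [265029, 578, 134354503,
  1936198, 17697, 17825, 30209, 29729, 67441415, 17042407, 770, 104992247, 2132806, 498, 521,
  541712, 607248, 672784, 1590288, 1918080, 117771239, 1918112, 2120768, 2132032, 84218743,
  2120752, 1925184, 1918016, 138675159, 2121760, 1204256, 1212448, 291888, 138609623]) (.split []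
  1616 (.close [16780119, 150997847, 17042263, 151259991, 1126432, 1146912, 1912864, 2257952,
  201463623, 67441479, 834]) (.split [] 2273 (.close [790230, 1117910, 706, 1117216, 541744,
  607280, 1197104, 2114608, 50662135, 134420167, 24065]) (.split [] 2345 (.close [201621, 786,
  1445782, 1511318, 658, 613424, 678960, 1203248, 1596464, 2186288, 266134, 528432, 659504,
  1577008, 138674967, 1607696, 1904672, 554048, 685120, 1602624, 2192448, 2257984, 67441527,
  84218743, 2245648, 100994999, 1078336, 521, 1523776, 498, 151260135, 104992247]) (.split [] 2282
  (.close [1781, 602870, 5877, 738]) (.split [] 1562 (.split [] 1566 (.close [131795, 2773,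
  330453, 131796, 134869, 658, 138609303, 1116886, 1213472, 1000480, 2180128, 50662087, 32865,
  521, 498, 104992247, 1721584, 17042407]) (.split [722, 265173] 609 (.close [1727504, 1727536,
  1727744, 1541376, 537, 205718423, 498, 914, 17041911, 521, 135125, 104992215, 235016135, 410640,
  2114576, 466, 50662087, 330709, 201529287, 962, 3029, 132052, 790486, 201685, 850]) (.split []
  563 (.split [] 593 (.close [1721600, 2114816, 2180352, 50662087]) (.split [] 605 (.close
  [1144064, 1733888, 2258176, 67441479, 67441415, 332613, 770, 265028, 2261830, 578, 17107527,
  1082182, 32865, 17042407, 521, 104992247, 498]) (.split [] 1612 (.split [201669] 68 (.split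
  [410640, 1212432, 1605648, 521, 498, 104992247, 537, 1009696, 17041863, 17041879, 151260135,
  416784, 613392, 678928, 1203216, 1596432, 2186256, 1737760, 450, 466, 1924352, 1073094, 1073110]
  862 (.close [2192432, 1935728, 134485895, 138609623, 898, 33885847, 1204118, 1328070, 658,
  199620, 1184662, 135109, 197524, 4053, 3989, 135125, 132052, 1183702, 201685, 850]) (.split []
  124 (.close [1523760, 100994999, 2187296, 1531968, 1537088, 138675159]) (.close [205718487,
  100994999, 2187296, 1531968, 1537088, 138675159]))) (.close [2100240, 2113552, 17042407,
  100797895, 104992215, 235016135, 104992247, 450, 466, 498, 1131462, 330709, 521, 2114576,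
  50662087, 2120752, 2120976, 1541392, 205718423, 201529223, 914, 898, 135125, 135109, 199620,
  330693, 3029, 132052, 790486, 201685, 850])) (.close [834, 332613, 151263047, 2180038, 265028,
  29937, 67441415, 770, 1934150, 1933568, 17042407, 100797895, 104992215, 100798407, 104992247,
  450, 466, 498, 330709, 521, 410640, 541712, 607248, 672784, 1197072, 2114576, 117771239,
  2120752, 24065, 1148870, 205718423, 201529223, 914, 898, 135125, 135109, 199620, 330693, 3029,
  132052, 790486, 201685, 850])))) (.close [1006608, 1534192, 537, 17041911, 498])))) (.close
  [706, 330437, 167909063, 5845, 199364, 17441, 17825, 17107527, 17042407, 578, 104992247,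
  1148614, 498, 521, 541712, 607248, 672784, 1262608, 50662135, 117771239, 2245776, 2132112,
  1143856, 1147952, 138609623, 2186288, 613424, 33885847, 33885879, 658, 690, 149206, 132853,
  131796, 131797, 66293, 66292, 329461, 83702, 242])))))))))))) (.close [1928256, 1928352,
  1928448, 1928544, 2258272, 67441527])) (.close [352288, 352320, 4457431]))) (.close [1970208,
  1985568, 1991712, 1997856, 30753, 4522967, 292912, 1275952, 1669168, 2062384, 5409, 1969184,
  234885047, 1577008, 221216, 4457431])) (.close [1585168, 270368, 274464, 275488, 281632, 286752,
  287776, 293920, 226497399, 1974336, 341056, 1985600, 30785, 1991744, 1997888, 292896, 4522967,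
  1603632, 1275952, 5409, 1669168, 2062384, 234885047]))) (.close [1475600, 1535008, 1535120,
  1535232, 1535328, 34145, 33886135, 1523760, 1529904, 23601, 1535024, 222495703, 1790000,
  33689079, 498, 521, 148496, 410640, 541712, 607248, 2114576, 2180112, 50334455, 50662135,
  205718487])) (.close [1134624, 1134720, 33009, 17107703])) (.close [1779776, 1785920, 1792064,
  1466432, 1796160, 189006807, 685120, 1078336, 35201, 67441527])) (.close [184814567, 1917088,
  1733888, 1799424, 2258176, 67441527, 1927232, 1928256, 29761, 189006807])))) (.close [88, 280,
  376, 472, 1978384, 2109456, 2174992, 2240528, 50334455, 1209376, 1184800, 208928, 1192992,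
  1197088, 1205280, 18465, 4391895, 2252848, 1575968, 548912, 2121776, 679984, 4385, 83891063])

def tree52 : Tr :=
  .split [41, 249, 361, 473, 395280, 143376, 40, 248, 360, 472, 216, 312, 408, 504, 536592,
  602128, 667664, 733200] 60 (.close [397328, 155664, 286736, 226497399, 352288, 117443063, 30785,
  1184800, 18465, 4391895, 4522967, 1183776, 292896]) (.split [1585168] 90 (.split [117443063,
  1576992, 1591328, 1592352, 1598496, 1604640] 77 (.close [1578016, 4457431, 1575968, 1183792,
  1269808, 1663024, 2056240, 234885047, 227360, 30769, 4522967]) (.close [1978384, 340000, 346144,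
  358432, 192943863])) (.close [1183776, 208928, 1192992, 1199136, 1211424, 18465, 4391895,
  1969184, 555056, 620592, 751664, 5409, 184555255]))

def tree53 : Tr :=
  .split [132051, 197587, 263123, 328659, 41, 249, 361, 328435, 329459, 331507, 473, 197107,
  198131, 199155, 265715, 537, 395280, 143376, 40, 408592, 151568, 1003536, 248, 415760, 1010704,
  1469456, 360, 422928, 165904, 1017872, 1935376, 472, 416784, 1006608, 1465360, 1924112, 2186256,
  216, 33689287, 312, 67309959, 408, 504, 536592, 544784, 551952, 559120, 54591735, 88146295,
  155255415, 602128, 610320, 613392, 617488, 624656, 104923575, 172032695, 386, 667664, 675856,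
  678928, 683024, 690192, 733200, 741392, 744464, 755728, 33689319] 49 (.close [537616, 603152,
  668688, 734224, 251726823]) (.split [864272, 872464, 886800] 67 (.close [556048, 621584, 752656,
  188815095]) (.split [2055184] 55 (.close [543760, 609296, 674832, 121703927]) (.split [1265680,
  1280016] 87 (.split [16779479, 16779511] 88 (.split [16779607, 16779639, 16779735] 89 (.split
  [16779863, 16779895, 16779991, 16780119] 862 (.split [134485895] 825 (.split [201528199, 898]
  130 (.close [1267760, 1333296, 27937, 33558007]) (.split [71504279, 71504311, 205722519] 562
  (.close [1457200, 2185456, 33689079, 1001520, 1334320, 222495703]) (.split [84087239, 88281559,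
  84087271, 218305479] 214 (.split [134485783, 134485911] 646 (.split [134485831, 134485847,
  134485959] 173 (.close [1607696, 1607712, 1995840, 35201, 226497399]) (.split [] 135 (.split []
  77 (.split [] 96 (.split [] 90 (.split [] 209 (.close [2000912, 554064, 619600, 1995856,
  2126928, 2192464, 142612215]) (.split [] 75 (.split [] 102 (.split [] 641 (.close [2131984,
  2132048, 1918080, 1918096, 2127120, 2192656, 142743287]) (.split [] 1557 (.close [33885879,
  38080183, 134901, 1541168, 23601, 138609303, 222495703, 1989648, 2167856, 754768, 1541200,
  2065488, 24033, 134223511, 134223607, 658, 33688791, 33688823, 33689303, 159389303, 2108496,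
  2120784, 32849, 151000663, 134869, 210, 242, 626, 59050727, 50662087, 594, 331478, 329461,
  198389, 706, 359126, 131796, 328405, 66293, 66292, 1781, 97014, 738]) (.split [] 213 (.close
  [1989648, 754768, 1541200, 2065488, 24033, 134223511, 134223543, 134223607, 159389303,
  192943863, 2108496, 2120784, 30769, 32849, 151000663, 690, 626, 1989680, 4391575, 59050727,
  50662087, 222495703, 594, 132853, 198389, 658, 706, 33688791, 33688823, 217814, 1969878, 210,
  242, 359126, 329461, 131796, 328405, 66293, 66292, 1781, 97014, 738]) (.split [38080151] 1569
  (.close [33689303, 33885911, 1326128, 1001520, 222495703]) (.split [] 2153 (.close [201109, 274,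
  4456727, 1183126, 1445270, 24625, 20545, 20529, 125832695, 146, 100797943, 1069104, 1200144,
  1206288, 265622, 1069072, 1009712, 1069184, 1069200, 1069232, 26865, 17042407, 2113584, 1015856,
  1721360, 1708080, 1130512, 1721392, 2113680, 2113712, 17825, 1721408, 1721584, 167909111,
  2123856, 1144880, 32849, 1144896, 2117712, 21300183]) (.split [] 1446 (.close [197011, 71500183,
  3477, 20529, 33557655, 197012, 146, 1184150, 125832695, 1183760, 1200144, 282640, 100797943,
  1069072, 1009680, 1069104, 1009712, 1069120, 1069184, 1009792, 1069216, 1069232, 1069296, 26865,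
  17042407, 2113552, 1736720, 2113584, 1721392, 2113600, 1721472, 2113696, 2113712, 2113776,
  17825, 1721584, 176297719, 2123856, 1144880, 360512, 2107472, 2108496, 32849, 2117712, 2113616,
  21300183, 1578048, 1669184, 2062400, 1734720, 201331575]) (.split [402] 2345 (.close [201621,
  786, 138674967, 1183638, 24625, 100666775]) (.split [] 1638 (.close [197523, 3989, 331669,
  197524, 268181, 658, 38077079, 1184662, 20561, 100666775, 1183792, 3313, 4385, 4391575, 292912,
  1007664, 226497399, 1575952, 217104, 100797943, 1069072, 1069104, 1069136, 1069184, 1009792,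
  1069296, 26865, 17042407, 2113552, 2113584, 2113616, 1721472, 2113776, 17825, 176297719])
  (.split [914, 135125] 2366 (.close [3029, 4053, 962]) (.split [] 2188 (.close [132597, 434,
  86518, 1266166, 466]) (.split [] 2189 (.close [198133, 201205, 370]) (.split [] 2177 (.close
  [201173, 338, 197077, 1314262, 1445334, 66037, 33688823, 210, 242, 265686, 263669, 66036, 1525,
  2549, 482, 100797927, 84470, 1069072, 1009680, 1069104, 1069184, 1009792, 1069296, 26865,
  17042407, 1196048, 1204240, 1589264, 2113552, 1736720, 2113584, 1721472, 2113776, 17825,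
  1721392, 1721408, 1721584, 176297719, 2123856, 32849, 1144880, 1144896, 2117712, 21300183])
  (.split [] 1350 (.split [4391063, 20529, 33557719, 100666775, 210, 24625] 1418 (.close
  [17041735, 26865, 100797895, 100797943, 450, 1315286, 2517, 131540, 134613, 217558, 331733, 338,
  67244375, 155452247, 155452375, 850, 1334336, 201685, 2192624, 132052, 1346518, 1315798, 722])
  (.split [322, 67244359, 16433, 16625, 16769, 155452247, 850, 201685] 164 (.close [1588272,
  100797943, 1009712, 1069072, 1069184, 1009792, 17042407, 1721392, 2113552, 2113664, 1721472,
  1736832, 2113584, 1721408, 2113776, 1721584, 1147136, 176297719, 2123856, 1144896, 2117712,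
  32849, 1144880, 21300183]) (.close [21234135, 155452375, 466, 1334336, 331733, 2192624, 132052,
  1346518, 1315798, 722]))) (.split [146, 33557655, 3169, 3313, 35105] 1470 (.close [88277463,
  66037, 33688823, 242, 263669, 66036, 1525, 2549, 482, 100797927, 1069072, 1009680, 1069104,
  1009712, 1069184, 1009792, 1069216, 1069232, 1069296, 26865, 17042407, 2113552, 1736720,
  2113584, 1721392, 1721472, 2113696, 2113712, 2113776, 17825, 1721584, 176297719, 2123856,
  360496, 1119280, 1144880, 2107472, 2108496, 32849, 2117712, 2113616, 21300183, 2127936, 1669184,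
  2062400, 5505, 1734720, 201331575]) (.split [466, 331733] 605 (.close [1916976, 1916992,
  1917008, 1738912, 1738992, 1144064, 35233, 67244919, 1073200, 1073216, 1734720, 1736768,
  21234647, 1986624, 2117696, 1724480, 100797911, 1341488, 1343536, 1337392, 21169111]) (.split []
  2174 (.close [2517, 450, 100797895, 1460694, 1069072, 1009680, 1009712, 1069184, 1069200,
  1069232, 1069296, 26865, 17042407, 210, 2113552, 1736720, 1721392, 2113680, 2113712, 2113776,
  17825, 1721584, 21168343, 281046, 2117680, 1605680, 167909111, 1144896, 1144880, 2114640,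
  2117712, 2123856, 1144912, 21300183]) (.split [] 2369 (.close [201685, 850, 1314774, 33688791,
  210, 262613, 131540, 217558, 283094, 338, 1326144, 1007680, 155452247, 1589312, 1075264,
  67244375]) (.split [132052, 268245, 722, 1315798] 566 (.split [100797911, 217104, 1319984,
  1322032] 66 (.close [398352, 358416, 1210384, 192943863, 21168855, 1197104, 360496, 622640,
  753712, 1015856, 1146928, 167909111]) (.close [1969168, 21168855, 1197104, 622640, 753712,
  1015856, 1146928, 1343536, 167909111, 32849, 2117712, 21299927])) (.close [1069120, 1069184,
  1069200, 1069232, 1069296, 26865, 17041863, 17042407, 151260135, 2113680, 2113712, 2113776,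
  17825, 151259975, 450, 1737968, 167909063, 834, 1200598, 1535942, 1335238, 706, 131540, 1328070,
  262613, 199620, 210, 135109, 33688791, 1184726, 217104, 1314864, 1335344, 1575952, 286768,
  226497399, 30785, 352304, 292912, 1981504, 1982528, 21300183, 2102320,
  167909111]))))))))))))))))))) (.close [1969184, 1971232, 1979424, 1991712, 1997856, 4522967,
  5505, 882752, 1669184, 2062400, 218108791])) (.close [1191952, 215072, 221216, 125832695])))
  (.close [208912, 1184800, 1204256, 18465, 4391895, 1575952, 1990704, 286768, 1183776, 226497399,
  1971264, 292896, 4522967])) (.close [1578016, 274464, 1586208, 1592352, 1598496, 24609, 4457431,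
  1183776, 876592, 1269808, 1663024, 4385, 117444087])) (.close [1978384, 335904, 340000, 341024,
  353312, 358432, 359456, 192943863, 1979440, 227360, 857136, 1974320, 1976368, 30769, 1977392,
  346144, 4391895, 1575968, 352304, 548912, 679984, 4385, 745520, 218108791])) (.close [1460272,
  1790000, 1793072, 222495703]))) (.close [1149056, 1149072, 1149088, 2258192, 1933584, 2262288,
  117771239])) (.close [2239568, 2251856, 2258000, 1931344, 2262096, 121963479, 753744, 1540176,
  17889, 134354679])))) (.close [33886135, 1529904, 1535024, 23601, 222495703, 1790000,
  33689079])) (.close [105189303, 754768, 1541200, 1934416, 2065488, 24033, 134223607, 2108496,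
  2120784, 2126928, 32849, 126159847])) (.close [148496, 1126432, 1133600, 1134624, 1145888,
  1146912, 172103415])) (.close [147472, 1060896, 1061920, 1063968, 1074208, 1075232, 1080352,
  205656951, 1140864, 1081584, 33025, 17107943])) (.close [104992247, 1009680, 1009696, 1069184,
  1069200, 1069232, 1069296, 26865, 17042407, 1721360, 1721376, 2113680, 2113712, 2113776, 17825,
  172103415]))))

def init42 : List ℕ :=
  [posl 6, cutl 0, neg (cutl 1), winl (del 63 1) 0, winl (del 63 0) 2, winl (del 63 2) 3, winl (del 63 3) 4, winl (del 63 4) 2]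

theorem chk42 : chk clause tree42 (start init42) = true := by
  decide +kernel

def init52 : List ℕ :=
  [posl 6, cutl 0, neg (cutl 1), winl (del 63 1) 0, winl (del 63 0) 2, winl (del 63 2) 3, winl (del 63 3) 4, winl (del 63 4) 5, winl (del 63 5) 2]

theorem chk52 : chk clause tree52 (start init52) = true := by
  decide +kernel

def init53 : List ℕ :=
  [posl 6, cutl 0, neg (cutl 1), winl (del 63 1) 0, winl (del 63 0) 2, winl (del 63 2) 3, winl (del 63 3) 4, winl (del 63 4) 5, winl (del 63 5) 3]

theorem chk53 : chk clause tree53 (start init53) = true := by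
  decide +kernel

end SSV

/-! ### Defeat in terms of cuts, and Simple Stable Voting for at most six alternatives -/

namespace SSV

/-- Margins that are antisymmetric and injective on pairs of distinct elements of `V`. -/
structure Marg (V : Finset X) (m : X → X → ℤ) : Prop where
  anti : ∀ x y, m x y = - m y x
  inj : ∀ a ∈ V, ∀ b ∈ V, ∀ c ∈ V, ∀ d ∈ V, a ≠ b → c ≠ d → (a ≠ c ∨ b ≠ d) → m a b ≠ m c d

/-- `y` defeats `x` in `U`: `y` beats `x`, and some cut separates `x` from `y` with respect to
the edges that are at least as strong as `(y, x)`. -/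
def Def (m : X → X → ℤ) (U : Finset X) (y x : X) : Prop :=
  x ∈ U ∧ y ∈ U ∧ 0 < m y x ∧ ∃ Z : Finset X, x ∈ Z ∧ y ∉ Z ∧
    ∀ p ∈ U, p ∈ Z → ∀ q ∈ U, q ∉ Z → m p q < m y x

/-- `S` selects the Simple Stable Voting winners. -/
structure Sel (V : Finset X) (m : X → X → ℤ) (S : Finset X → X) : Prop where
  mem : ∀ B ⊆ V, B.Nonempty → S B ∈ B
  top : ∀ B ⊆ V, 1 < B.card → ∃ b ∈ B, S (B.erase b) = S B ∧
    ∀ d ∈ B, d ≠ b → m (S (B.erase d)) d < m (S B) b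

theorem Def.mono {m : X → X → ℤ} {U U' : Finset X} {y x : X} (h : Def m U y x) (hU : U' ⊆ U)
    (hx : x ∈ U') (hy : y ∈ U') : Def m U' y x := by
  obtain ⟨_, _, h1, Z, h2, h3, h4⟩ := h
  exact ⟨hx, hy, h1, Z, h2, h3, fun p hp hpZ q hq hqZ => h4 p (hU hp) hpZ q (hU hq) hqZ⟩

theorem cut_of_undefeated {V : Finset X} {m : X → X → ℤ} (hm : Marg V m) {B : Finset X}
    (hB : B ⊆ V) {s y : X} (hs : s ∈ B) (hu : ∀ y, ¬ Def m B y s) (hy : y ∈ B) (hlt : m s y < m y s)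
    (Z : Finset X) (hsZ : s ∈ Z) (hyZ : y ∉ Z) :
    ∃ p ∈ B, p ∈ Z ∧ ∃ q ∈ B, q ∉ Z ∧ m y s < m p q := by
  by_contra hc
  push Not at hc
  have h0 := hm.anti s y
  refine hu y ⟨hs, hy, by omega, Z, hsZ, hyZ, fun p hp hpZ q hq hqZ => ?_⟩
  refine lt_of_le_of_ne (hc p hp hpZ q hq hqZ) ?_
  refine hm.inj p (hB hp) q (hB hq) y (hB hy) s (hB hs) ?_ ?_ (Or.inl ?_)
  · rintro rfl; exact hqZ hpZ
  · rintro rfl; exact hyZ hsZ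
  · rintro rfl; exact hyZ hpZ

/-- The case of an `f`-orbit `a, x, y, z, x, …` in a five-element set. -/
theorem case5 {V : Finset X} {m : X → X → ℤ} (hm : Marg V m) {a b x y z : X}
    {U : Finset X} (hUV : U ⊆ V) (hU : U = {a, b, x, y, z})
    (hab : a ≠ b) (hax : a ≠ x) (hay : a ≠ y) (haz : a ≠ z) (hbx : b ≠ x) (hby : b ≠ y)
    (hbz : b ≠ z) (hxy : x ≠ y) (hxz : x ≠ z) (hyz : y ≠ z)
    (h1 : ∀ d, ¬ Def m (U.erase b) d a) (h2 : ∀ d, ¬ Def m (U.erase y) d z)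
    (h3 : ∀ d, ¬ Def m (U.erase z) d x) (ht : 0 < m b a)
    (hxa : m b a < m a x) (hxb : m x b < m b a) (hzb : m z b < m b a) : False := by
  have sub : ∀ d, U.erase d ⊆ V := fun d => (Finset.erase_subset _ _).trans hUV
  have a1 := hm.anti a x
  have a2 := hm.anti a y
  have a3 := hm.anti a z
  have hya : m a x < m y a := by
    obtain ⟨p, hp, hpZ, q, hq, hqZ, h⟩ := cut_of_undefeated hm (sub z)
      (by simp [hU, hxz]) h3 (y := a) (by simp [hU, haz]) (by omega) {x, b, y} (by simp)
      (by simp [hax, hab, hay])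
    have hq' : q = a := by
      simp only [hU, Finset.mem_erase, Finset.mem_insert, Finset.mem_singleton] at hq hqZ
      tauto
    subst hq'
    simp only [Finset.mem_insert, Finset.mem_singleton] at hpZ
    rcases hpZ with rfl | rfl | rfl <;> omega
  have haz' : m y a < m a z := by
    obtain ⟨p, hp, hpZ, q, hq, hqZ, h⟩ := cut_of_undefeated hm (sub b)
      (by simp [hU, hab]) h1 (y := y) (by simp [hU, hby.symm]) (by omega) {a} (by simp)
      (by simp [hay.symm])
    have hp' : p = a := by simpa using hpZ
    subst hp'
    have hq' : q = x ∨ q = y ∨ q = z := by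
      simp only [hU, Finset.mem_erase, Finset.mem_insert, Finset.mem_singleton] at hq hqZ
      tauto
    rcases hq' with rfl | rfl | rfl <;> omega
  obtain ⟨p, hp, hpZ, q, hq, hqZ, h⟩ := cut_of_undefeated hm (sub y)
    (by simp [hU, hyz.symm]) h2 (y := a) (by simp [hU, hay]) (by omega) {z, x} (by simp)
    (by simp [haz, hax])
  have hq' : q = a ∨ q = b := by
    simp only [hU, Finset.mem_erase, Finset.mem_insert, Finset.mem_singleton] at hq hqZ
    tauto
  simp only [Finset.mem_insert, Finset.mem_singleton] at hpZ
  rcases hpZ with rfl | rfl <;> rcases hq' with rfl | rfl <;> omega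

/-- A labelling of six alternatives. -/
def lab (a b x y z u : X) : ℕ → X
  | 0 => a
  | 1 => b
  | 2 => x
  | 3 => y
  | 4 => z
  | _ => u

theorem case6 {V : Finset X} {m : X → X → ℤ} (hm : Marg V m) {S : Finset X → X}
    (hS : Sel V m S) {a b x y z u : X}
    {U : Finset X} (hUV : U ⊆ V) (hU : U = {a, b, x, y, z, u}) (hcard : U.card = 6)
    (hund : ∀ B, B ⊂ U → B.Nonempty → ∀ d, ¬ Def m B d (S B))
    (hd : 0 < m b a) (R : Finset X) (haR : a ∈ R) (hbR : b ∉ R)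
    (hR : ∀ p ∈ U, p ∈ R → ∀ q ∈ U, q ∉ R → m p q < m b a)
    (hF : ∀ d ∈ U, d ≠ b → m b a < m d (S (U.erase d)))
    (fb : S (U.erase b) = a) (fa : S (U.erase a) = x) (fx : S (U.erase x) = y)
    (fy : S (U.erase y) = z)
    (hz : S (U.erase z) = x ∨ (S (U.erase z) = u ∧ (S (U.erase u) = x ∨ S (U.erase u) = y))) :
    False := by
  have hfs : fs (lab a b x y z u) 63 = U := by
    ext p
    rw [mem_fs, hU]
    simp only [Finset.mem_insert, Finset.mem_singleton]
    constructor
    · rintro ⟨i, hi, -, rfl⟩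
      interval_cases i <;> simp [lab]
    · rintro (rfl | rfl | rfl | rfl | rfl | rfl)
      · exact ⟨0, by norm_num, by decide, rfl⟩
      · exact ⟨1, by norm_num, by decide, rfl⟩
      · exact ⟨2, by norm_num, by decide, rfl⟩
      · exact ⟨3, by norm_num, by decide, rfl⟩
      · exact ⟨4, by norm_num, by decide, rfl⟩
      · exact ⟨5, by norm_num, by decide, rfl⟩
  have himg : (Finset.range 6).image (lab a b x y z u) = U := by
    rw [← hfs]
    ext p
    rw [mem_fs, Finset.mem_image]
    have t63 : ∀ i < 6, Nat.testBit 63 i = true := by decide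
    constructor
    · rintro ⟨i, hi, h⟩
      exact ⟨i, Finset.mem_range.1 hi, t63 i (Finset.mem_range.1 hi), h⟩
    · rintro ⟨i, hi, -, h⟩
      exact ⟨i, Finset.mem_range.2 hi, h⟩
  have hmem : ∀ i < 6, lab a b x y z u i ∈ U := by
    intro i hi
    rw [← himg]
    exact Finset.mem_image_of_mem _ (Finset.mem_range.2 hi)
  have hinj : ∀ i < 6, ∀ j < 6, lab a b x y z u i = lab a b x y z u j → i = j := by
    have : Set.InjOn (lab a b x y z u) (Finset.range 6 : Finset ℕ) := by
      apply Finset.injOn_of_card_image_eq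
      rw [himg, hcard, Finset.card_range]
    intro i hi j hj h
    exact this (by simpa using hi) (by simpa using hj) h
  have hE : ∀ B : Finset X, ∃ e : X, B ⊂ U → 1 < B.card → e ∈ B ∧ S (B.erase e) = S B ∧
      ∀ d ∈ B, d ≠ e → m (S (B.erase d)) d < m (S B) e := by
    intro B
    by_cases h : B ⊂ U ∧ 1 < B.card
    · obtain ⟨e, h1, h2, h3⟩ := hS.top B (h.1.subset.trans hUV) h.2
      exact ⟨e, fun _ _ => ⟨h1, h2, h3⟩⟩
    · exact ⟨a, fun h1 h2 => absurd ⟨h1, h2⟩ h⟩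
  choose E hE using hE
  let K : Ctx X :=
    { m := m
      e := lab a b x y z u
      S := S
      E := E
      R := R
      anti := hm.anti
      einj := hinj
      minj := by
        intro i hi j hj k hk l hl h1 h2 h3
        refine hm.inj _ (hUV (hmem i hi)) _ (hUV (hmem j hj)) _ (hUV (hmem k hk)) _
          (hUV (hmem l hl)) (fun h => h1 (hinj _ hi _ hj h)) (fun h => h2 (hinj _ hk _ hl h)) ?_
        rcases h3 with h3 | h3
        · exact Or.inl fun h => h3 (hinj _ hi _ hk h)
        · exact Or.inr fun h => h3 (hinj _ hj _ hl h)
      hS := by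
        rw [hfs]
        intro B hB hne
        exact hS.mem B (hB.subset.trans hUV) hne
      hE := by
        rw [hfs]
        exact hE
      hC := by
        rw [hfs]
        intro B hB hne y hy hlt Z h1 h2
        exact cut_of_undefeated hm (hB.subset.trans hUV) (hS.mem B (hB.subset.trans hUV) hne)
          (hund B hB hne) hy hlt Z h1 h2
      hR := fun i hi j hj h1 h2 => hR _ (hmem i hi) h1 _ (hmem j hj) h2
      hF := by
        rw [hfs]
        intro i hi h1
        exact hF _ (hmem i hi) fun h => h1 (hinj _ hi 1 (by norm_num) h) }
  have l1 : lit K.atom (posl 6) := (K.posl_iff (p := 6) (by decide)).2 hd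
  have l2 : lit K.atom (cutl 0) := K.cutl_iff.2 haR
  have l3 : lit K.atom (neg (cutl 1)) := (lit_neg _ _).2 (fun h => hbR (K.cutl_iff.1 h))
  have hw : ∀ d < 6, ∀ c < 6, S (U.erase (lab a b x y z u d)) = lab a b x y z u c →
      lit K.atom (winl (del 63 d) c) := by
    intro d h1 c h2 h
    rw [K.winl_iff (del_lt (by norm_num) h1) h2, K.fs_del (by
      have : ∀ i < 6, has 63 i = true := by decide
      exact this d h1)]
    change S ((fs (lab a b x y z u) 63).erase _) = _
    rw [hfs]
    exact h
  have w1 := hw 1 (by norm_num) 0 (by norm_num) fb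
  have w0 := hw 0 (by norm_num) 2 (by norm_num) fa
  have w2 := hw 2 (by norm_num) 3 (by norm_num) fx
  have w3 := hw 3 (by norm_num) 4 (by norm_num) fy
  rcases hz with hz | ⟨hz, hu | hu⟩
  · have w4 := hw 4 (by norm_num) 2 (by norm_num) hz
    refine K.refute init42 tree42 ?_ chk42
    simp only [init42, List.forall_mem_cons, List.not_mem_nil, false_imp_iff, implies_true,
      and_true]
    exact ⟨l1, l2, l3, w1, w0, w2, w3, w4⟩
  · have w4 := hw 4 (by norm_num) 5 (by norm_num) hz
    have w5 := hw 5 (by norm_num) 2 (by norm_num) hu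
    refine K.refute init52 tree52 ?_ chk52
    simp only [init52, List.forall_mem_cons, List.not_mem_nil, false_imp_iff, implies_true,
      and_true]
    exact ⟨l1, l2, l3, w1, w0, w2, w3, w4, w5⟩
  · have w4 := hw 4 (by norm_num) 5 (by norm_num) hz
    have w5 := hw 5 (by norm_num) 3 (by norm_num) hu
    refine K.refute init53 tree53 ?_ chk53
    simp only [init53, List.forall_mem_cons, List.not_mem_nil, false_imp_iff, implies_true,
      and_true]
    exact ⟨l1, l2, l3, w1, w0, w2, w3, w4, w5⟩

theorem rot5 (a b x y z u : X) :
    insert u ({a, b, x, y, z} : Finset X) = {a, b, x, y, z, u} := by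
  ext p
  simp only [Finset.mem_insert, Finset.mem_singleton]
  tauto

/-- For at most six alternatives, the Simple Stable Voting winner is undefeated. -/
theorem undefeated_le_six {V : Finset X} {m : X → X → ℤ} (hm : Marg V m) {S : Finset X → X}
    (hS : Sel V m S) : ∀ (n : ℕ) (U : Finset X), U.card = n → n ≤ 6 → U ⊆ V → U.Nonempty →
      ∀ d, ¬ Def m U d (S U) := by
  intro n
  induction n using Nat.strong_induction_on with
  | _ n ih =>
  intro U hn hn6 hUV hne y0 hdef
  have hund : ∀ B, B ⊂ U → B.Nonempty → ∀ d, ¬ Def m B d (S B) := by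
    intro B hB hBne
    have := Finset.card_lt_card hB
    exact ih B.card (by omega) B rfl (by omega) (hB.subset.trans hUV) hBne
  obtain ⟨haU, hyU, hpos, -⟩ := id hdef
  have hy0 : y0 ≠ S U := by
    rintro h
    have := hm.anti y0 (S U)
    rw [← h] at this hpos
    omega
  have hc1 : 1 < U.card := Finset.one_lt_card.2 ⟨_, hyU, _, haU, hy0⟩
  have hun : ∀ c ∈ U, ∀ d, ¬ Def m (U.erase c) d (S (U.erase c)) := by
    intro c hc
    refine hund _ (Finset.erase_ssubset hc) ?_
    rw [← Finset.card_pos, Finset.card_erase_of_mem hc]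
    omega
  have hfm : ∀ c ∈ U, S (U.erase c) ∈ U ∧ S (U.erase c) ≠ c := by
    intro c hc
    have := hS.mem (U.erase c) ((Finset.erase_subset _ _).trans hUV) (by
      rw [← Finset.card_pos, Finset.card_erase_of_mem hc]
      omega)
    rw [Finset.mem_erase] at this
    exact this.symm
  obtain ⟨b, hb, fb, hF⟩ := hS.top U hUV hc1
  have hba : S U ≠ b := by
    have := (hfm b hb).2
    rwa [fb] at this
  -- the defeater is `b`
  have hyb : y0 = b := by
    by_contra hne'
    have h := hun b hb y0
    rw [fb] at h
    exact h (hdef.mono (Finset.erase_subset _ _) (Finset.mem_erase.2 ⟨hba, haU⟩)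
      (Finset.mem_erase.2 ⟨hne', hyU⟩))
  subst hyb
  -- names
  obtain ⟨a, ha⟩ : ∃ a, a = S U := ⟨_, rfl⟩
  rw [← ha] at hdef haU hpos hy0 fb hF hba
  obtain ⟨-, -, -, R, haR, hbR, hR⟩ := id hdef
  have hF' : ∀ d ∈ U, d ≠ y0 → m y0 a < m d (S (U.erase d)) := by
    intro d hd hne'
    have h1 := hF d hd hne'
    have h2 := hm.anti (S (U.erase d)) d
    have h3 := hm.anti a y0
    omega
  have hRc : ∀ p ∈ U, p ∈ R → S (U.erase p) ∈ R := by
    intro p hp hpR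
    by_contra hc
    have h1 := hR p hp hpR _ (hfm p hp).1 hc
    have h2 := hF' p hp (by rintro rfl; exact hbR hpR)
    omega
  have hna : ∀ d ∈ U, d ≠ y0 → S (U.erase d) ≠ a := by
    intro d hd hdb hc
    have h := hun d hd y0
    have hda : d ≠ a := by rintro rfl; exact (hfm d hd).2 hc
    rw [hc] at h
    exact h (hdef.mono (Finset.erase_subset _ _) (Finset.mem_erase.2 ⟨hda.symm, haU⟩)
      (Finset.mem_erase.2 ⟨hdb.symm, hyU⟩))
  -- the orbit of `a`
  have step : ∀ p ∈ U, p ∈ R → ∃ q ∈ U, q ∈ R ∧ S (U.erase p) = q ∧ q ≠ p ∧ q ≠ a ∧ q ≠ y0 ∧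
      m y0 a < m p q := by
    intro p hp hpR
    have hpb : p ≠ y0 := by rintro rfl; exact hbR hpR
    refine ⟨_, (hfm p hp).1, hRc p hp hpR, rfl, (hfm p hp).2, hna p hp hpb, ?_, hF' p hp hpb⟩
    intro h
    have := hRc p hp hpR
    rw [h] at this
    exact hbR this
  obtain ⟨x, hxU, hxR, fa, hxa, -, hxb, max'⟩ := step a haU haR
  obtain ⟨y, hyU', hyR, fx, hyx, hya, hyb, mxy⟩ := step x hxU hxR
  obtain ⟨z, hzU, hzR, fy, hzy, hza, hzb, myz⟩ := step y hyU' hyR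
  obtain ⟨z', hzU', hzR', fz, hzz', hza', hzb', mzz⟩ := step z hzU hzR
  have anti := hm.anti
  have hzx : z ≠ x := by
    rintro rfl
    have := anti y z
    omega
  have hzy' : z' ≠ y := by
    rintro rfl
    have := anti z' z
    omega
  have hsub5 : ({a, y0, x, y, z} : Finset X) ⊆ U := by
    intro p hp
    simp only [Finset.mem_insert, Finset.mem_singleton] at hp
    rcases hp with rfl | rfl | rfl | rfl | rfl <;> assumption
  have hc5 : ({a, y0, x, y, z} : Finset X).card = 5 := by
    rw [Finset.card_insert_of_notMem, Finset.card_insert_of_notMem, Finset.card_insert_of_notMem,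
      Finset.card_insert_of_notMem, Finset.card_singleton]
    all_goals simp only [Finset.mem_insert, Finset.mem_singleton, not_or]
    · exact hzy.symm
    · exact ⟨hyx.symm, hzx.symm⟩
    · exact ⟨hxb.symm, hyb.symm, hzb.symm⟩
    · exact ⟨hba, hxa.symm, hya.symm, hza.symm⟩
  have hge : 5 ≤ U.card := hc5 ▸ Finset.card_le_card hsub5
  have hlast : ∀ u ∈ U, u ∉ ({a, y0, x, y, z} : Finset X) →
      U = {a, y0, x, y, z, u} ∧ U.card = 6 := by
    intro u hu hun'
    have hs : insert u ({a, y0, x, y, z} : Finset X) ⊆ U := Finset.insert_subset hu hsub5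
    have hc : (insert u ({a, y0, x, y, z} : Finset X)).card = 6 := by
      rw [Finset.card_insert_of_notMem hun', hc5]
    have h6 : U.card = 6 := by
      have := Finset.card_le_card hs
      omega
    refine ⟨?_, h6⟩
    rw [← Finset.eq_of_subset_of_card_le hs (by omega)]
    exact rot5 a y0 x y z u
  by_cases hz'x : z' = x
  · rw [hz'x] at fz
    by_cases h5 : U.card = 5
    · have hU : U = {a, y0, x, y, z} := (Finset.eq_of_subset_of_card_le hsub5 (by omega)).symm
      refine case5 hm hUV hU hba hxa.symm hya.symm hza.symm hxb.symm hyb.symm hzb.symm hyx.symm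
        hzx.symm hzy.symm ?_ ?_ ?_ hpos max' (hR x hxU hxR y0 hyU hbR) (hR z hzU hzR y0 hyU hbR)
      · have := hun y0 hyU; rwa [fb] at this
      · have := hun y hyU'; rwa [fy] at this
      · have := hun z hzU; rwa [fz] at this
    · obtain ⟨u, hu, hun'⟩ : ∃ u ∈ U, u ∉ ({a, y0, x, y, z} : Finset X) := by
        by_contra hc
        push Not at hc
        have := Finset.card_le_card (show U ⊆ ({a, y0, x, y, z} : Finset X) from hc)
        omega
      obtain ⟨hU, h6⟩ := hlast u hu hun'
      exact case6 hm hS hUV hU h6 hund hpos R haR hbR hR hF' fb fa fx fy (Or.inl fz)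
  · obtain ⟨hU, h6⟩ := hlast z' hzU' (by
      simp only [Finset.mem_insert, Finset.mem_singleton, not_or]
      exact ⟨hza', hzb', hz'x, hzy', hzz'⟩)
    obtain ⟨v, hvU, -, fv, hvz', hva, hvb, mv⟩ := step z' hzU' hzR'
    have hvz : v ≠ z := by
      rintro rfl
      have := anti z' v
      omega
    have hv : v = x ∨ v = y := by
      rw [hU] at hvU
      simp only [Finset.mem_insert, Finset.mem_singleton] at hvU
      tauto
    refine case6 hm hS hUV hU h6 hund hpos R haR hbR hR hF' fb fa fx fy (Or.inr ⟨fz, ?_⟩)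
    rw [fv]
    exact hv

end SSV

/-! ### From the order `succ` to margins and back -/

namespace SSV

open Classical in
theorem exists_margin {V : Finset X} {succ : X × X → X × X → Prop} (h : IsLinearOMM V succ) :
    ∃ m : X → X → ℤ, Marg V m ∧ ∀ a ∈ V, ∀ b ∈ V, ∀ c ∈ V, ∀ d ∈ V,
      (succ (a, b) (c, d) ↔ m c d < m a b) := by
  obtain ⟨⟨-, hasym, hneg, hskew⟩, hlin⟩ := h
  let r : X × X → ℕ := fun p => ((V ×ˢ V).filter fun q => succ p q).card
  have hr : ∀ p q : X × X, p.1 ∈ V → p.2 ∈ V → q.1 ∈ V → q.2 ∈ V → (succ p q ↔ r q < r p) := by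
    intro p q hp1 hp2 hq1 hq2
    constructor
    · intro hpq
      apply Finset.card_lt_card
      rw [Finset.ssubset_iff_of_subset]
      · refine ⟨q, ?_, ?_⟩
        · simp only [Finset.mem_filter, Finset.mem_product]
          exact ⟨⟨hq1, hq2⟩, hpq⟩
        · simp only [Finset.mem_filter, Finset.mem_product, not_and]
          intro _ h
          exact hasym q q hq1 hq2 hq1 hq2 h h
      · intro s hs
        simp only [Finset.mem_filter, Finset.mem_product] at hs ⊢
        refine ⟨hs.1, ?_⟩
        by_contra hc
        exact hneg p s q hp1 hp2 hs.1.1 hs.1.2 hq1 hq2 hc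
          (hasym q s hq1 hq2 hs.1.1 hs.1.2 hs.2) hpq
    · intro hlt
      by_contra hc
      refine absurd hlt (not_lt.2 (Finset.card_le_card ?_))
      intro s hs
      simp only [Finset.mem_filter, Finset.mem_product] at hs ⊢
      refine ⟨hs.1, ?_⟩
      by_contra hc'
      exact hneg p q s hp1 hp2 hq1 hq2 hs.1.1 hs.1.2 hc hc' hs.2
  have key : ∀ a ∈ V, ∀ b ∈ V, ∀ c ∈ V, ∀ d ∈ V,
      (succ (a, b) (c, d) ↔ (r (c, d) : ℤ) - r (d, c) < (r (a, b) : ℤ) - r (b, a)) := by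
    intro a ha b hb c hc d hd
    have h1 := hr (a, b) (c, d) ha hb hc hd
    have h2 := hr (d, c) (b, a) hd hc hb ha
    have h3 := hskew a b c d ha hb hc hd
    rw [← h3] at h2
    constructor
    · intro h
      have := h1.1 h
      have := h2.1 h
      omega
    · intro h
      by_contra hn
      have h4 : ¬ r (c, d) < r (a, b) := fun h => hn (h1.2 h)
      have h5 : ¬ r (b, a) < r (d, c) := fun h => hn (h2.2 h)
      omega
  refine ⟨fun a b => (r (a, b) : ℤ) - r (b, a), ⟨fun x y => by ring, ?_⟩, key⟩
  intro a ha b hb c hc d hd hab hcd hne heq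
  have hne' : (a, b) ≠ (c, d) := by
    intro h
    rw [Prod.mk.injEq] at h
    rcases hne with h' | h'
    · exact h' h.1
    · exact h' h.2
  rcases hlin a b c d ha hb hc hd hab hcd hne' with h | h
  · have := (key a ha b hb c hc d hd).1 h
    omega
  · have := (key c hc d hd a ha b hb).1 h
    omega

theorem exists_ssv {V : Finset X} {succ : X × X → X × X → Prop} {m : X → X → ℤ}
    (hm : Marg V m) (hs : ∀ a ∈ V, ∀ b ∈ V, ∀ c ∈ V, ∀ d ∈ V,
      (succ (a, b) (c, d) ↔ m c d < m a b)) :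
    ∀ (n : ℕ) (U : Finset X), U.card = n + 1 → U ⊆ V →
      ∃ a ∈ U, ∀ a', SSVwinAux succ (n + 1) U a' ↔ a' = a := by
  intro n
  induction n with
  | zero =>
    intro U hU _
    obtain ⟨a, rfl⟩ := Finset.card_eq_one.1 hU
    refine ⟨a, Finset.mem_singleton_self a, fun a' => ?_⟩
    simp only [SSVwinAux, Finset.singleton_inj, Finset.card_singleton, lt_irrefl, false_and,
      or_false]
    exact eq_comm
  | succ n ih =>
    intro U hU hUV
    have h1 : ∀ d : X, ∃ w : X, d ∈ U →
        w ∈ U.erase d ∧ ∀ a', SSVwinAux succ (n + 1) (U.erase d) a' ↔ a' = w := by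
      intro d
      by_cases hd : d ∈ U
      · obtain ⟨w, hw1, hw2⟩ := ih (U.erase d) (by rw [Finset.card_erase_of_mem hd]; omega)
          ((Finset.erase_subset _ _).trans hUV)
        exact ⟨w, fun _ => ⟨hw1, hw2⟩⟩
      · exact ⟨d, fun h => absurd h hd⟩
    choose W hW using h1
    have hne : U.Nonempty := by rw [← Finset.card_pos]; omega
    obtain ⟨b, hb, hmax⟩ := Finset.exists_max_image U (fun d => m (W d) d) hne
    have hWU : ∀ d ∈ U, W d ∈ V := fun d hd => hUV (Finset.mem_of_mem_erase (hW d hd).1)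
    have hWne : ∀ d ∈ U, W d ≠ d := fun d hd => Finset.ne_of_mem_erase (hW d hd).1
    refine ⟨W b, Finset.mem_of_mem_erase (hW b hb).1, fun a' => ⟨?_, ?_⟩⟩
    · rintro (h | ⟨-, b', hb', hab', haux, hall⟩)
      · rw [h, Finset.card_singleton] at hU
        omega
      · have ha' := ((hW b' hb').2 a').1 haux
        subst ha'
        by_contra hcon
        have h2 := hall (W b) b hb (hW b hb).1 (by
          intro h
          rw [Prod.mk.injEq] at h
          exact hcon h.1.symm) (((hW b hb).2 _).2 rfl)
        rw [hs _ (hWU b' hb') _ (hUV hb') _ (hWU b hb) _ (hUV hb)] at h2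
        have h3 := hmax b' hb'
        omega
    · rintro rfl
      refine Or.inr ⟨by omega, b, hb, (hW b hb).1, ((hW b hb).2 _).2 rfl, ?_⟩
      intro c d hd hcd hne' haux
      have hc := ((hW d hd).2 c).1 haux
      subst hc
      rw [hs _ (hWU b hb) _ (hUV hb) _ (hWU d hd) _ (hUV hd)]
      refine lt_of_le_of_ne (hmax d hd) ?_
      refine hm.inj _ (hWU d hd) _ (hUV hd) _ (hWU b hb) _ (hUV hb) (hWne d hd) (hWne b hb) ?_
      by_contra hcon
      push Not at hcon
      exact hne' (Prod.ext hcon.1 hcon.2)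

theorem exists_sel {V : Finset X} {succ : X × X → X × X → Prop} {m : X → X → ℤ}
    (hm : Marg V m) (hs : ∀ a ∈ V, ∀ b ∈ V, ∀ c ∈ V, ∀ d ∈ V,
      (succ (a, b) (c, d) ↔ m c d < m a b)) (x0 : X) :
    ∃ S : Finset X → X, Sel V m S ∧
      ∀ U ⊆ V, U.Nonempty → ∀ a, SSVwinAux succ U.card U a ↔ a = S U := by
  have h1 : ∀ U : Finset X, ∃ w : X, U ⊆ V → U.Nonempty →
      w ∈ U ∧ ∀ a, SSVwinAux succ U.card U a ↔ a = w := by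
    intro U
    by_cases h : U ⊆ V ∧ U.Nonempty
    · have hc := Finset.card_pos.2 h.2
      obtain ⟨w, hw1, hw2⟩ := exists_ssv hm hs (U.card - 1) U (by omega) h.1
      rw [Nat.sub_add_cancel hc] at hw2
      exact ⟨w, fun _ _ => ⟨hw1, hw2⟩⟩
    · exact ⟨x0, fun h1 h2 => absurd ⟨h1, h2⟩ h⟩
  choose S hS using h1
  refine ⟨S, ⟨fun B hB hne => (hS B hB hne).1, ?_⟩, fun U hU hne => (hS U hU hne).2⟩
  intro B hB hcard
  have hne : B.Nonempty := by rw [← Finset.card_pos]; omega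
  have haux := ((hS B hB hne).2 (S B)).2 rfl
  obtain ⟨n, hn⟩ : ∃ n, B.card = n + 1 := ⟨B.card - 1, by omega⟩
  have hE : ∀ d ∈ B, S (B.erase d) ∈ B.erase d ∧
      ∀ a, SSVwinAux succ n (B.erase d) a ↔ a = S (B.erase d) := by
    intro d hd
    have hc : (B.erase d).card = n := by rw [Finset.card_erase_of_mem hd]; omega
    have := hS (B.erase d) ((Finset.erase_subset _ _).trans hB) (by
      rw [← Finset.card_pos]; omega)
    rwa [hc] at this
  rw [hn] at haux
  rcases haux with h | ⟨-, b, hb, hab, haux, hall⟩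
  · have := congrArg Finset.card h
    rw [Finset.card_singleton] at this
    omega
  · refine ⟨b, hb, (((hE b hb).2 _).1 haux).symm, ?_⟩
    intro d hd hdb
    have h2 := hall (S (B.erase d)) d hd (hE d hd).1 (by
      intro h
      rw [Prod.mk.injEq] at h
      exact hdb h.2) (((hE d hd).2 _).2 rfl)
    rwa [hs _ (hB (hS B hB hne).1) _ (hB hb) _ (hB (Finset.mem_of_mem_erase (hE d hd).1)) _
      (hB hd)] at h2

/-! ### Split Cycle defeat is defeat by a cut -/

theorem exists_nodup_path {E : X → X → Prop} {x y : X} (h : Relation.ReflTransGen E x y) :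
    ∃ t : List X, (x :: t).Nodup ∧ (x :: t).IsChain E ∧
      (x :: t).getLast (List.cons_ne_nil _ _) = y := by
  induction h using Relation.ReflTransGen.head_induction_on with
  | refl => exact ⟨[], by simp, by simp, by simp⟩
  | head hxz _ ih =>
    rename_i x z _
    obtain ⟨t, h1, h2, h3⟩ := ih
    by_cases hx : x ∈ z :: t
    · obtain ⟨s, t', hst⟩ := List.append_of_mem hx
      refine ⟨t', ?_, ?_, ?_⟩
      · rw [hst] at h1
        exact (List.nodup_append.1 h1).2.1
      · rw [hst] at h2
        exact (List.isChain_append.1 h2).2.1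
      · rw [← h3]
        simp only [hst]
        rw [List.getLast_append_of_ne_nil _ (List.cons_ne_nil _ _)]
    · refine ⟨z :: t, List.nodup_cons.2 ⟨hx, h1⟩, ?_, ?_⟩
      · exact List.IsChain.cons_cons hxz h2
      · rw [List.getLast_cons (List.cons_ne_nil _ _)]
        exact h3

theorem mem_zip_rotate {l : List X} {e : X × X} :
    e ∈ l.zip (l.rotate 1) ↔ ∃ (i : ℕ) (h : i < l.length),
      e = (l[i], l[(i + 1) % l.length]'(Nat.mod_lt _ (by omega))) := by
  rw [List.mem_iff_getElem]
  constructor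
  · rintro ⟨i, hi, rfl⟩
    have hi' : i < l.length := by
      rw [List.length_zip, List.length_rotate] at hi
      omega
    refine ⟨i, hi', ?_⟩
    rw [List.getElem_zip, List.getElem_rotate]
  · rintro ⟨i, hi, rfl⟩
    refine ⟨i, by rw [List.length_zip, List.length_rotate]; omega, ?_⟩
    rw [List.getElem_zip, List.getElem_rotate]

theorem Def.scdefeats {V : Finset X} {succ : X × X → X × X → Prop} {m : X → X → ℤ}
    (hm : Marg V m) (hs : ∀ a ∈ V, ∀ b ∈ V, ∀ c ∈ V, ∀ d ∈ V,
      (succ (a, b) (c, d) ↔ m c d < m a b)) {y x : X} (h : Def m V y x) :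
    SCdefeats V succ y x := by
  obtain ⟨hx, hy, hpos, Z, hxZ, hyZ, hZ⟩ := h
  refine ⟨hy, hx, ?_, ?_⟩
  · rw [hs y hy x hx x hx y hy]
    have := hm.anti x y
    omega
  · rintro ⟨l, -, hl, -, hyx, hw⟩
    obtain ⟨i, hi, hyx⟩ := mem_zip_rotate.1 hyx
    rw [Prod.mk.injEq] at hyx
    obtain ⟨hyi, hxi⟩ := hyx
    have hlen : 0 < l.length := by omega
    have hstep : ∀ k : ℕ, l[(i + 1 + k) % l.length]'(Nat.mod_lt _ hlen) ∈ Z := by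
      intro k
      induction k with
      | zero =>
        simp only [Nat.add_zero]
        rwa [← hxi]
      | succ k ih =>
        by_contra hc
        have hj : (i + 1 + k) % l.length < l.length := Nat.mod_lt _ hlen
        have hmem := mem_zip_rotate.2 ⟨(i + 1 + k) % l.length, hj, rfl⟩
        have h2 := hw _ hmem
        have heq : ((i + 1 + k) % l.length + 1) % l.length = (i + 1 + (k + 1)) % l.length := by
          rw [Nat.mod_add_mod]
          rfl
        simp only [heq] at h2
        apply h2
        rw [hs y hy x hx _ (hl _ (List.getElem_mem _)) _ (hl _ (List.getElem_mem _))]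
        exact hZ _ (hl _ (List.getElem_mem _)) ih _ (hl _ (List.getElem_mem _)) hc
    have h3 := hstep (l.length - 1)
    have heq : (i + 1 + (l.length - 1)) % l.length = i := by
      rw [show i + 1 + (l.length - 1) = i + l.length by omega, Nat.add_mod_right,
        Nat.mod_eq_of_lt hi]
    simp only [heq] at h3
    rw [← hyi] at h3
    exact hyZ h3

open Classical in
theorem def_of_scdefeats {V : Finset X} {succ : X × X → X × X → Prop} {m : X → X → ℤ}
    (hm : Marg V m) (hs : ∀ a ∈ V, ∀ b ∈ V, ∀ c ∈ V, ∀ d ∈ V,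
      (succ (a, b) (c, d) ↔ m c d < m a b)) {y x : X} (h : SCdefeats V succ y x) :
    Def m V y x := by
  obtain ⟨hy, hx, hyx, hno⟩ := h
  rw [hs y hy x hx x hx y hy] at hyx
  have hanti := hm.anti x y
  have hpos : 0 < m y x := by omega
  let E : X → X → Prop := fun p q => p ∈ V ∧ q ∈ V ∧ m y x < m p q
  refine ⟨hx, hy, hpos, V.filter fun p => Relation.ReflTransGen E x p, ?_, ?_, ?_⟩
  · exact Finset.mem_filter.2 ⟨hx, Relation.ReflTransGen.refl⟩
  · intro hyZ
    obtain ⟨t, h1, h2, h3⟩ := exists_nodup_path (Finset.mem_filter.1 hyZ).2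
    have hlV : ∀ p ∈ x :: t, p ∈ V := by
      intro p hp
      obtain ⟨i, hi, rfl⟩ := List.mem_iff_getElem.1 hp
      rcases Nat.eq_zero_or_pos i with rfl | h0
      · simpa using hx
      · obtain ⟨j, rfl⟩ : ∃ j, i = j + 1 := ⟨i - 1, by omega⟩
        exact (List.isChain_iff_getElem.1 h2 j hi).2.1
    have hedge : ∀ e ∈ (x :: t).zip ((x :: t).rotate 1), e = (y, x) ∨ E e.1 e.2 := by
      intro e he
      obtain ⟨i, hi, rfl⟩ := mem_zip_rotate.1 he
      by_cases hi' : i + 1 < (x :: t).length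
      · right
        simp only [Nat.mod_eq_of_lt hi']
        exact List.isChain_iff_getElem.1 h2 i hi'
      · left
        have hi2 : i = (x :: t).length - 1 := by omega
        have hi3 : (i + 1) % (x :: t).length = 0 := by
          rw [show i + 1 = (x :: t).length by omega, Nat.mod_self]
        simp only [hi3]
        rw [← h3, List.getLast_eq_getElem]
        simp only [hi2]
        rfl
    have hyx' : (y, x) ∈ (x :: t).zip ((x :: t).rotate 1) := by
      rw [mem_zip_rotate]
      refine ⟨(x :: t).length - 1, by simp, ?_⟩
      have hi3 : ((x :: t).length - 1 + 1) % (x :: t).length = 0 := by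
        rw [show (x :: t).length - 1 + 1 = (x :: t).length by simp, Nat.mod_self]
      simp only [hi3]
      rw [← h3, List.getLast_eq_getElem]
      rfl
    refine hno ⟨x :: t, h1, hlV, ?_, hyx', ?_⟩
    · intro e he
      rcases hedge e he with rfl | ⟨e1, e2, e3⟩
      · rwa [hs y hy x hx x hx y hy]
      · rw [hs _ e1 _ e2 _ e2 _ e1]
        have := hm.anti e.1 e.2
        omega
    · intro e he
      rcases hedge e he with rfl | ⟨e1, e2, e3⟩
      · rw [hs y hy x hx y hy x hx]
        exact lt_irrefl _
      · rw [hs y hy x hx _ e1 _ e2]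
        omega
  · intro p hp hpZ q hq hqZ
    have h1 : ¬ m y x < m p q := by
      intro hc
      exact hqZ (Finset.mem_filter.2 ⟨hq, (Finset.mem_filter.1 hpZ).2.tail ⟨hp, hq, hc⟩⟩)
    by_cases hpy : p = y ∧ q = x
    · exfalso
      apply hqZ
      rw [hpy.2]
      exact Finset.mem_filter.2 ⟨hx, Relation.ReflTransGen.refl⟩
    · refine lt_of_le_of_ne (not_lt.1 h1) ?_
      refine hm.inj p hp q hq y hy x hx ?_ ?_ ?_
      · rintro rfl
        exact hqZ hpZ
      · rintro rfl
        omega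
      · by_contra hc
        push Not at hc
        exact hpy hc

/-! ### Seven alternatives -/

theorem exists_crossing {r : X → X → Prop} {P : X → Prop} {a c : X}
    (h : Relation.ReflTransGen r a c) (ha : P a) (hc : ¬ P c) :
    ∃ p q, Relation.ReflTransGen r a p ∧ P p ∧ r p q ∧ ¬ P q ∧ Relation.ReflTransGen r q c := by
  induction h using Relation.ReflTransGen.head_induction_on with
  | refl => exact absurd ha hc
  | head hab hbc ih =>
    rename_i a b
    by_cases hb : P b
    · obtain ⟨p, q, h1, h2, h3, h4, h5⟩ := ih hb
      exact ⟨p, q, h1.head hab, h2, h3, h4, h5⟩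
    · exact ⟨a, b, Relation.ReflTransGen.refl, ha, hab, hb, hbc⟩

/-- A defeat is never on a closed walk of defeats and of edges at least as strong as it. -/
theorem no_return {m : X → X → ℤ} {V : Finset X} (μ : ℤ) :
    ∀ (N : ℕ) (c a : X), (m c a).toNat = N → Def m V c a → m c a ≤ μ →
      ¬ Relation.ReflTransGen (fun p q => Def m V p q ∨ (p ∈ V ∧ q ∈ V ∧ μ ≤ m p q)) a c := by
  intro N
  induction N using Nat.strong_induction_on with
  | _ N ih =>
  intro c a hN hca hμ hwalk
  obtain ⟨ha, hc, hpos, Z, haZ, hcZ, hZ⟩ := id hca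
  obtain ⟨p, q, h1, h2, h3, h4, h5⟩ := exists_crossing (P := fun x => x ∈ Z) hwalk haZ hcZ
  rcases h3 with h3 | ⟨hp, hq, h3⟩
  · have hlt := hZ p h3.2.1 h2 q h3.1 h4
    have hpos' := h3.2.2.1
    refine ih (m p q).toNat (by omega) p q rfl h3 (by omega) ?_
    exact (h5.tail (Or.inl hca)).trans h1
  · have hlt := hZ p hp h2 q hq h4
    omega

theorem Def.acyclic {m : X → X → ℤ} {V : Finset X} {c a : X} (h : Def m V c a)
    (h' : Relation.ReflTransGen (Def m V) a c) : False :=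
  no_return (m c a) _ c a rfl h le_rfl (Relation.ReflTransGen.mono (fun _ _ h => Or.inl h) _ _ h')

theorem Def.weak {m : X → X → ℤ} {V : Finset X} {c a w d : X} (h : Def m V c a)
    (hw : w ∈ V) (hd : d ∈ V) (h1 : Relation.ReflTransGen (Def m V) w c)
    (h2 : Relation.ReflTransGen (Def m V) a d) : m d w < m c a := by
  by_contra hc
  refine no_return (m c a) _ c a rfl h le_rfl ?_
  refine (Relation.ReflTransGen.tail (Relation.ReflTransGen.mono (fun _ _ h => Or.inl h) _ _ h2) (Or.inr ⟨hd, hw, not_lt.1 hc⟩)).trans ?_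
  exact Relation.ReflTransGen.mono (fun _ _ h => Or.inl h) _ _ h1

open Classical in
theorem exists_source {r : X → X → Prop} {V : Finset X} (hr : ∀ a b, r a b → a ∈ V)
    (hac : ∀ a b, r a b → ¬ Relation.ReflTransGen r b a) :
    ∀ (n : ℕ) (c : X), (V.filter fun p => Relation.TransGen r p c).card = n →
      ∃ w, Relation.ReflTransGen r w c ∧ ∀ y, ¬ r y w := by
  intro n
  induction n using Nat.strong_induction_on with
  | _ n ih =>
  intro c hn
  by_cases hc : ∃ y, r y c
  · obtain ⟨y, hy⟩ := hc
    obtain ⟨w, h1, h2⟩ := ih _ (by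
      rw [← hn]
      apply Finset.card_lt_card
      rw [Finset.ssubset_iff_of_subset]
      · refine ⟨y, Finset.mem_filter.2 ⟨hr y c hy, Relation.TransGen.single hy⟩, ?_⟩
        intro hcon
        obtain ⟨b, hb1, hb2⟩ := Relation.TransGen.head'_iff.1 (Finset.mem_filter.1 hcon).2
        exact hac y b hb1 hb2
      · intro p hp
        rw [Finset.mem_filter] at hp ⊢
        exact ⟨hp.1, hp.2.tail hy⟩) y rfl
    exact ⟨w, h1.tail hy, h2⟩
  · push Not at hc
    exact ⟨c, Relation.ReflTransGen.refl, hc⟩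

theorem seven {V : Finset X} {m : X → X → ℤ} (hm : Marg V m) {S : Finset X → X}
    (hS : Sel V m S) (hcard : V.card = 7) {w : X} (hwV : w ∈ V) (hw : ∀ y, ¬ Def m V y w)
    (huniq : ∀ x ∈ V, (∀ y, ¬ Def m V y x) → x = w) : S V = w := by
  by_contra hne
  have hsix : ∀ d ∈ V, S (V.erase d) ∈ V.erase d ∧
      ∀ y, ¬ Def m (V.erase d) y (S (V.erase d)) := by
    intro d hd
    have hc : (V.erase d).card = 6 := by rw [Finset.card_erase_of_mem hd, hcard]
    have hn : (V.erase d).Nonempty := by rw [← Finset.card_pos]; omega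
    exact ⟨hS.mem _ (Finset.erase_subset _ _) hn,
      undefeated_le_six hm hS 6 _ hc le_rfl (Finset.erase_subset _ _) hn⟩
  obtain ⟨c, hc, hSc, htop⟩ := hS.top V subset_rfl (by omega)
  have haV : S V ∈ V := hS.mem V subset_rfl ⟨w, hwV⟩
  -- `S V` is defeated by `c`
  have hca : Def m V c (S V) := by
    by_contra hcon
    apply hne
    refine huniq _ haV fun y hy => ?_
    have hyc : y ≠ c := by
      rintro rfl
      exact hcon hy
    obtain ⟨h1, h2⟩ := hsix c hc
    rw [hSc] at h1 h2
    exact h2 y (hy.mono (Finset.erase_subset _ _) h1 (Finset.mem_erase.2 ⟨hyc, hy.2.1⟩))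
  -- a sink below `S V`
  obtain ⟨d, had, hdsink⟩ : ∃ d, Relation.ReflTransGen (Def m V) (S V) d ∧
      ∀ y, ¬ Def m V d y := by
    obtain ⟨d, h1, h2⟩ := exists_source (r := Function.swap (Def m V)) (V := V)
      (fun a b h => h.1) (fun a b h h' => Def.acyclic h (Relation.reflTransGen_swap.1 h'))
      _ (S V) rfl
    exact ⟨d, Relation.reflTransGen_swap.1 h1, h2⟩
  have hdw : d ≠ w := by
    rintro rfl
    rcases Relation.ReflTransGen.cases_tail had with h | ⟨y, -, h⟩
    · exact hne h.symm
    · exact hw y h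
  have hdc : d ≠ c := by
    rintro rfl
    exact hdsink _ hca
  have hdV : d ∈ V := by
    rcases Relation.ReflTransGen.cases_tail had with h | ⟨y, -, h⟩
    · rw [h]; exact haV
    · exact h.1
  -- `w` is above `c`
  have hwc : Relation.ReflTransGen (Def m V) w c := by
    obtain ⟨w', h1, h2⟩ := exists_source (r := Def m V) (V := V)
      (fun a b h => h.2.1) (fun a b h h' => Def.acyclic h h') _ c rfl
    have hw'V : w' ∈ V := by
      rcases Relation.ReflTransGen.cases_head h1 with h | ⟨y, h, -⟩
      · rw [h]; exact hc
      · exact h.2.1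
    rwa [huniq w' hw'V h2] at h1
  have hlt := hca.weak hwV hdV hwc had
  have hSd : S (V.erase d) = w := by
    obtain ⟨h1, h2⟩ := hsix d hdV
    refine huniq _ (Finset.mem_of_mem_erase h1) fun y hy => ?_
    have hyd : y ≠ d := by
      rintro rfl
      exact hdsink _ hy
    exact h2 y (hy.mono (Finset.erase_subset _ _) h1 (Finset.mem_erase.2 ⟨hyd, hy.2.1⟩))
  have h1 := htop d hdV hdc
  rw [hSd] at h1
  have h2 := hm.anti w d
  have h3 := hm.anti (S V) c
  omega

end SSV

/-- For every linear ordinal margin matrix with exactly 7 alternatives that has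
exactly one Split Cycle winner, the SSV winner is that Split Cycle winner. -/
theorem ssv_eq_unique_sc_winner_seven {X : Type} [DecidableEq X] (V : Finset X)
    (succ : X × X → X × X → Prop) (hlin : IsLinearOMM V succ) (hcard : V.card = 7)
    (w : X) (hw : SCwinner V succ w) (huniq : ∀ w', SCwinner V succ w' → w' = w) :
    ∀ a, SSVwin V succ a → a = w := by
  intro a ha
  obtain ⟨m, hm, hs⟩ := SSV.exists_margin hlin
  obtain ⟨S, hS, hSV⟩ := SSV.exists_sel hm hs w
  rw [(hSV V subset_rfl ⟨w, hw.1⟩ a).1 ha]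
  refine SSV.seven hm hS hcard hw.1 (fun y hy => hw.2 y hy.2.1 (hy.scdefeats hm hs)) ?_
  intro x hx hu
  exact huniq x ⟨hx, fun b _ hb => hu b (SSV.def_of_scdefeats hm hs hb)⟩
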